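/- Under the standing hypotheses, if an edge xy of G lies in two distinct g-cycles of G, then it is not the case that both x lies in some g-cycle of G not containing y and y lies in some g-cycle of G not containing x. -/

import Mathlib

open SimpleGraph

/-- Two graphs have the same `k`-deck if there is a bijection between their `k`-element
vertex subsets under which corresponding induced subgraphs are isomorphic. -/
def SameDeck {V W : Type*} [Fintype V] [Fintype W] [DecidableEq V] [DecidableEq W]
    (G : SimpleGraph V) (H : SimpleGraph W) (k : ℕ) : Prop :=
  ∃ e : {s : Finset V // s.card = k} ≃ {s : Finset W // s.card = k},
    ∀ s : {s : Finset V // s.card = k},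
      Nonempty ((G.induce (↑s.1 : Set V)) ≃g (H.induce (↑(e s).1 : Set W)))

namespace TwoDeck

variable {V W : Type*} {G H K : SimpleGraph V} {g : ℕ} {u v : V}

/-- There is a walk from `p` to `q` of length at most `k` avoiding the set `A`. -/
def Avoids (G : SimpleGraph V) (A : Set V) (k : ℤ) (p q : V) : Prop :=
  ∃ w : G.Walk p q, (w.length : ℤ) ≤ k ∧ ∀ z ∈ w.support, z ∉ A

lemma Avoids.symm {A : Set V} {k : ℤ} {p q : V} (h : Avoids G A k p q) : Avoids G A k q p := by
  obtain ⟨w, h1, h2⟩ := h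
  exact ⟨w.reverse, by simpa using h1, by simpa using h2⟩

lemma Avoids.mono {A B : Set V} {k l : ℤ} {p q : V} (h : Avoids G A k p q) (hB : B ⊆ A)
    (hk : k ≤ l) : Avoids G B l p q := by
  obtain ⟨w, h1, h2⟩ := h
  exact ⟨w, h1.trans hk, fun z hz hzB ↦ h2 z hz (hB hzB)⟩

lemma Avoids.cons {A : Set V} {k : ℤ} {p q r : V} (h : Avoids G A k q r) (hpq : G.Adj p q)
    (hp : p ∉ A) : Avoids G A (k + 1) p r := by
  obtain ⟨w, h1, h2⟩ := h
  refine ⟨.cons hpq w, by simpa using h1, ?_⟩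
  intro z hz
  rw [Walk.support_cons, List.mem_cons] at hz
  rcases hz with rfl | hz
  exacts [hp, h2 z hz]

lemma Avoids.transfer {A : Set V} {k : ℤ} {p q : V} (h : Avoids G A k p q)
    (hH : ∀ s t, s ∉ A → t ∉ A → G.Adj s t → H.Adj s t) : Avoids H A k p q := by
  obtain ⟨w, h1, h2⟩ := h
  induction w generalizing k with
  | nil => exact ⟨.nil, by simpa using h1, by simpa using h2⟩
  | @cons a b c hab w ih =>
    have := ih (k := k - 1) (by simp at h1; lia) (fun z hz ↦ h2 z (by simp [hz]))
    have := this.cons (hH _ _ (h2 _ (by simp)) (h2 _ (by simp)) hab) (h2 _ (by simp))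
    simpa using this

/-- Two distinct neighbours of `u` joined by a walk avoiding `u` span a cycle through `u`. -/
lemma le_of_avoids (hG : (g : ℕ∞) ≤ G.egirth) {A : Set V} {u p q : V} {k : ℤ} (hu : u ∈ A)
    (h : Avoids G A k p q) (hp : G.Adj u p) (hq : G.Adj u q) (hpq : p ≠ q) : (g : ℤ) ≤ k + 2 := by
  classical
  obtain ⟨w, h1, h2⟩ := h
  have hu' : u ∉ w.bypass.support := fun h ↦ h2 u (w.support_bypass_subset_support h) hu
  have hpath : (w.bypass.concat hq.symm).IsPath := (w.bypass_isPath).concat hu' hq.symm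
  have hc : (Walk.cons hp (w.bypass.concat hq.symm)).IsCycle := by
    rw [Walk.cons_isCycle_iff]
    refine ⟨hpath, ?_⟩
    rw [Walk.edges_concat, List.concat_eq_append, List.mem_append, not_or]
    refine ⟨fun h ↦ hu' (Walk.fst_mem_support_of_mem_edges _ h), ?_⟩
    simp only [List.mem_singleton, Sym2.eq_iff]
    rintro (⟨rfl, _⟩ | ⟨_, h⟩)
    exacts [hq.ne rfl, hpq h]
  have h3 := hG.trans (egirth_le_length hc)
  have h4 := w.length_bypass_le_length
  simp only [Walk.length_cons, Walk.length_concat] at h3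
  have h5 : g ≤ w.bypass.length + 1 + 1 := by exact_mod_cast h3
  lia

/-- `p` winds bi-infinitely around a cycle of length `g` of `G`. -/
structure Winds (g : ℕ) (G : SimpleGraph V) (p : ℤ → V) : Prop where
  dvd : ∀ i j, p i = p j → (g : ℤ) ∣ j - i
  add : ∀ i, p (i + g) = p i
  adj : ∀ i, G.Adj (p i) (p (i + 1))

namespace Winds

variable {p q : ℤ → V}

lemma shift (h : Winds g G p) (k : ℤ) : Winds g G (fun i ↦ p (i + k)) where
  dvd i j hij := by simpa using h.dvd _ _ hij
  add i := by rw [← h.add (i + k)]; congr 1; ring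
  adj i := by have := h.adj (i + k); rwa [add_right_comm] at this

lemma sub (h : Winds g G p) (i : ℤ) : p (i - g) = p i := by rw [← h.add]; simp

lemma neg (h : Winds g G p) : Winds g G (fun i ↦ p (-i)) where
  dvd i j hij := by have := h.dvd _ _ hij; rwa [← dvd_neg, show -(j - i) = -j - -i by ring]
  add i := by rw [neg_add]; exact h.sub _
  adj i := by have := h.adj (-(i + 1)); simpa [add_comm, sub_eq_add_neg] using this.symm

lemma ne (h : Winds g G p) {i j : ℤ} (hij : i < j) (hji : j < i + g) : p i ≠ p j := by
  intro he
  have := Int.le_of_dvd (by lia) (h.dvd _ _ he)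
  lia

lemma ne' (h : Winds g G p) {i j : ℤ} (hij : i < j) (hji : j < i + g) : p j ≠ p i :=
  (h.ne hij hji).symm

lemma adj' (h : Winds g G p) {i j : ℤ} (hij : j = i + 1) : G.Adj (p i) (p j) := hij ▸ h.adj i

lemma add_mul (h : Winds g G p) (n i : ℤ) : p (i + n * g) = p i := by
  have hper : ∀ (n : ℕ) i, p (i + n * g) = p i := by
    intro n
    induction n with
    | zero => simp
    | succ n ih => intro i; rw [← ih i, ← h.add (i + n * g)]; congr 1; push_cast; ring
  obtain ⟨m, rfl | rfl⟩ := n.eq_nat_or_neg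
  · exact hper m i
  · rw [← hper m]; congr 1; ring

lemma exists_index (h : Winds g G p) (hg : 0 < g) (k i : ℤ) :
    ∃ j, i ≤ j ∧ j < i + g ∧ p j = p k := by
  have h1 := Int.emod_add_mul_ediv (k - i) g
  refine ⟨i + (k - i) % g, by have := Int.emod_nonneg (k - i) (b := g) (by lia); lia,
    by have := Int.emod_lt_of_pos (k - i) (b := g) (by lia); lia, ?_⟩
  rw [← h.add_mul ((k - i) / g)]
  congr 1
  linarith

lemma exists_index_ne (h : Winds g G p) (hg : 0 < g) {k i : ℤ} (hne : p k ≠ p i) :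
    ∃ j, i < j ∧ j < i + g ∧ p j = p k := by
  obtain ⟨j, h1, h2, h3⟩ := h.exists_index hg k i
  exact ⟨j, lt_of_le_of_ne h1 (by rintro rfl; exact hne h3.symm), h2, h3⟩

end Winds

lemma avoids_segment {p : ℤ → V} {A : Set V} {i j : ℤ} (hij : i ≤ j)
    (hadj : ∀ l, i ≤ l → l < j → G.Adj (p l) (p (l + 1)))
    (hA : ∀ l, i ≤ l → l ≤ j → p l ∉ A) : Avoids G A (j - i) (p i) (p j) := by
  obtain ⟨n, hn⟩ := Int.eq_ofNat_of_zero_le (sub_nonneg.2 hij)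
  induction n generalizing i with
  | zero => obtain rfl : i = j := by lia
            exact ⟨.nil, by simp, by simpa using hA i le_rfl le_rfl⟩
  | succ n ih =>
    have := ih (i := i + 1) (by lia) (fun l h ↦ hadj l (by lia)) (fun l h ↦ hA l (by lia)) (by lia)
    convert this.cons (hadj i le_rfl (by lia)) (hA i le_rfl hij) using 1
    ring

namespace Winds

variable {p q : ℤ → V}

lemma avoids (h : Winds g G p) {A : Set V} {i j k : ℤ} (hij : i ≤ j) (hk : j - i ≤ k)
    (hA : ∀ l, i ≤ l → l ≤ j → p l ∉ A) : Avoids G A k (p i) (p j) :=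
  (avoids_segment hij (fun l _ _ ↦ h.adj l) hA).mono subset_rfl hk

lemma chordless (h : Winds g G p) (hG : (g : ℕ∞) ≤ G.egirth) (hg : 0 < g) {i k : ℤ}
    (hadj : G.Adj (p i) (p k)) : p k = p (i + 1) ∨ p k = p (i - 1) := by
  obtain ⟨j, h1, h2, h3⟩ := h.exists_index_ne hg hadj.ne'
  rw [← h3] at hadj ⊢
  by_contra! hcon
  have hj1 : j ≠ i + 1 := by rintro rfl; exact hcon.1 rfl
  have hj2 : j ≠ i - 1 + g := by rintro rfl; exact hcon.2 (h.add _)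
  have := le_of_avoids hG (A := {p i}) rfl (h.avoids (i := i + 1) (j := j) (by lia) le_rfl
    (fun l hl hl' ↦ by simpa using h.ne' (by lia) (by lia))) (h.adj i) hadj hcon.1.symm
  lia

lemma ne_of (h : Winds g G p) {i l : ℤ} {z : V} (hz : p i = z) (hne : l ≠ i := by lia)
    (hil : i < l + g := by lia) (hli : l < i + g := by lia) : p l ≠ z := by
  rcases hne.lt_or_gt with hlt | hlt
  exacts [hz ▸ h.ne hlt hil, hz ▸ h.ne' hlt hli]

lemma add_eq (h : Winds g G p) {i : ℤ} {z : V} (hz : p i = z) : p (i + g) = z :=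
  (h.add i).trans hz

lemma adj_of (h : Winds g G p) {i j : ℤ} {z w : V} (hz : p i = z) (hw : p j = w)
    (hij : j = i + 1 := by lia) : G.Adj z w :=
  hz ▸ hw ▸ h.adj' hij

lemma avoids_of (h : Winds g G p) {A : Set V} {i j k : ℤ} {z w : V} (hz : p i = z) (hw : p j = w)
    (hA : ∀ l, i ≤ l → l ≤ j → p l ∉ A) (hij : i ≤ j := by lia) (hk : j - i ≤ k := by lia) :
    Avoids G A k z w :=
  hz ▸ hw ▸ h.avoids hij hk hA

/-- A neighbour of a vertex of the cycle is off the cycle unless it is next to it there. -/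
lemma forall_ne (h : Winds g G p) (hG : (g : ℕ∞) ≤ G.egirth) (hg : 0 < g) {i : ℤ} {z w : V}
    (hz : p i = z) (hadj : G.Adj z w) (h1 : p (i + 1) ≠ w) (h2 : p (i - 1) ≠ w) (k : ℤ) :
    p k ≠ w := by
  rintro rfl
  rcases h.chordless hG hg (hz.symm ▸ hadj) with h3 | h3
  exacts [h1 h3.symm, h2 h3.symm]

lemma exists_oriented (h : Winds g G p) (hG : (g : ℕ∞) ≤ G.egirth) (hg : 0 < g) {z w : V}
    (hz : ∃ i, p i = z) (hw : ∃ i, p i = w) (hadj : G.Adj z w) :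
    ∃ q, Winds g G q ∧ q 0 = z ∧ q 1 = w ∧ (∀ v, (∃ i, q i = v) ↔ ∃ i, p i = v) ∧
      ∀ e, (∃ i, e = s(q i, q (i + 1))) ↔ ∃ i, e = s(p i, p (i + 1)) := by
  obtain ⟨i, rfl⟩ := hz
  obtain ⟨k, rfl⟩ := hw
  rcases h.chordless hG hg hadj with hk | hk
  · refine ⟨_, h.shift i, by simp, by rw [hk, add_comm], fun v ↦ ⟨?_, ?_⟩, fun e ↦ ⟨?_, ?_⟩⟩
    · rintro ⟨j, rfl⟩; exact ⟨_, rfl⟩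
    · rintro ⟨j, rfl⟩; exact ⟨j - i, by simp⟩
    · rintro ⟨j, rfl⟩; exact ⟨j + i, by rw [add_right_comm]⟩
    · rintro ⟨j, rfl⟩; exact ⟨j - i, by rw [add_right_comm]; simp⟩
  · refine ⟨_, (h.shift i).neg, by simp, by rw [hk, sub_eq_neg_add], fun v ↦ ⟨?_, ?_⟩,
      fun e ↦ ⟨?_, ?_⟩⟩
    · rintro ⟨j, rfl⟩; exact ⟨_, rfl⟩
    · rintro ⟨j, rfl⟩; exact ⟨i - j, by simp⟩
    · rintro ⟨j, rfl⟩
      exact ⟨i - j - 1, by rw [Sym2.eq_swap]; congr 2 <;> ring_nf⟩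
    · rintro ⟨j, rfl⟩
      exact ⟨i - j - 1, by rw [Sym2.eq_swap]; congr 2 <;> ring_nf⟩

end Winds

lemma getVert_emod_succ {v : V} (c : G.Walk v v) (hc : c.IsCycle) (hl : c.length = g) (i : ℤ) :
    c.getVert ((i + 1) % g).toNat = c.getVert ((i % g).toNat + 1) := by
  have h3 := hc.three_le_length
  have hnn : 0 ≤ i % g := Int.emod_nonneg _ (by lia)
  have hlt : i % g < g := Int.emod_lt_of_pos _ (by lia)
  by_cases h : i % g = g - 1
  · have h4 : (i + 1) % g = 0 := by
      rw [Int.add_emod, h, Int.emod_eq_of_lt (a := 1) (by lia) (by lia)]; simp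
    rw [h4, h, show ((g : ℤ) - 1).toNat + 1 = c.length by lia, c.getVert_length]
    simp
  · have h4 : (i + 1) % g = i % g + 1 := by
      rw [Int.add_emod, Int.emod_eq_of_lt (a := 1) (by lia) (by lia),
        Int.emod_eq_of_lt (by lia) (by lia)]
    rw [h4]
    congr 1
    lia

lemma mem_edges_iff_getVert {u v : V} (c : G.Walk u v) {e : Sym2 V} :
    e ∈ c.edges ↔ ∃ n < c.length, e = s(c.getVert n, c.getVert (n + 1)) := by
  simp only [List.mem_iff_getElem, Walk.getElem_edges, Walk.length_edges, exists_prop, eq_comm]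

lemma exists_winds_of_isCycle {v : V} (c : G.Walk v v) (hc : c.IsCycle) (hl : c.length = g) :
    ∃ p, Winds g G p ∧ (∀ z, z ∈ c.support ↔ ∃ i, p i = z) ∧
      ∀ e, e ∈ c.edges ↔ ∃ i, e = s(p i, p (i + 1)) := by
  have h3 := hc.three_le_length
  have hnn (i : ℤ) : 0 ≤ i % g := Int.emod_nonneg _ (by lia)
  have hlt (i : ℤ) : i % g < g := Int.emod_lt_of_pos _ (by lia)
  have hs := getVert_emod_succ c hc hl
  have hcast {n : ℕ} (hn : n < g) : ((n : ℤ) % g).toNat = n := by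
    rw [Int.emod_eq_of_lt (by lia) (by lia)]; simp
  refine ⟨fun i ↦ c.getVert (i % g).toNat, ⟨fun i j hij ↦ ?_, fun i ↦ by simp, fun i ↦ ?_⟩,
    fun z ↦ ⟨fun hz ↦ ?_, ?_⟩, fun e ↦ ?_⟩
  · have h1 := hnn i
    have h2 := hnn j
    have h3 := hlt i
    have h4 := hlt j
    have := hc.getVert_injOn' (by simp only [Set.mem_ofPred_eq]; lia)
      (by simp only [Set.mem_ofPred_eq]; lia) hij
    exact Int.ModEq.dvd (show i % g = j % g by lia)
  · simp only [hs]
    have h1 := hnn i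
    have h2 := hlt i
    exact c.adj_getVert_succ (by lia)
  · obtain ⟨n, rfl, hn⟩ := Walk.mem_support_iff_exists_getVert.1 hz
    rcases hn.lt_or_eq with hn | rfl
    · exact ⟨n, by simp only [hcast (hl ▸ hn)]⟩
    · exact ⟨0, by simp⟩
  · rintro ⟨i, rfl⟩
    exact c.getVert_mem_support _
  · rw [mem_edges_iff_getVert]
    simp only [hs]
    constructor
    · rintro ⟨n, hn, rfl⟩
      exact ⟨n, by rw [hcast (hl ▸ hn)]⟩
    · rintro ⟨i, rfl⟩
      have h1 := hnn i
      have h2 := hlt i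
      exact ⟨(i % g).toNat, by lia, rfl⟩

section Deck

variable [Fintype V] [DecidableEq V] [Fintype W] [DecidableEq W]

lemma sameDeck_symm {H : SimpleGraph W} {k : ℕ} (h : SameDeck G H k) : SameDeck H G k := by
  obtain ⟨e, he⟩ := h
  refine ⟨e.symm, fun s ↦ ?_⟩
  obtain ⟨f⟩ := he (e.symm s)
  rw [e.apply_symm_apply] at f
  exact ⟨f.symm⟩

lemma sameDeck_of_iso {H : SimpleGraph W} {k : ℕ} (h : SameDeck G H k) (f : H ≃g K) :
    SameDeck G K k := by
  obtain ⟨e, he⟩ := h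
  let e' : {s : Finset W // s.card = k} ≃ {s : Finset V // s.card = k} :=
    f.toEquiv.finsetCongr.subtypeEquiv (by simp)
  refine ⟨e.trans e', fun s ↦ ?_⟩
  obtain ⟨i⟩ := he s
  refine ⟨i.trans ?_⟩
  refine ⟨f.toEquiv.subtypeEquiv (by simp [e']), ?_⟩
  rintro ⟨a, ha⟩ ⟨b, hb⟩
  exact f.map_adj_iff

/-- If `G` and `H` have the same `(n-2)`-deck, then a copy of `H` agrees with `G` off `u`, `v`. -/
lemma exists_iso_agree (h : SameDeck G H (Fintype.card V - 2)) (huv : u ≠ v) :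
    ∃ K : SimpleGraph V, Nonempty (K ≃g H) ∧
      ∀ s t, s ≠ u → s ≠ v → t ≠ u → t ≠ v → (K.Adj s t ↔ G.Adj s t) := by
  obtain ⟨e, he⟩ := h
  let S : {s : Finset V // s.card = Fintype.card V - 2} :=
    ⟨({u, v} : Finset V)ᶜ, by rw [Finset.card_compl, Finset.card_pair huv]⟩
  obtain ⟨f⟩ := he S
  let ψ : Equiv.Perm V := Equiv.extendSubtype f.toEquiv
  have hψ (x : V) (hx : x ∈ (S.1 : Set V)) : ψ x = f ⟨x, hx⟩ :=
    Equiv.extendSubtype_apply_of_mem _ _ hx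
  refine ⟨H.comap ψ, ⟨Iso.comap ψ H⟩, fun s t h1 h2 h3 h4 ↦ ?_⟩
  have hs : s ∈ (S.1 : Set V) := by simp [S, h1, h2]
  have ht : t ∈ (S.1 : Set V) := by simp [S, h3, h4]
  rw [comap_adj, hψ s hs, hψ t ht]
  exact f.map_adj_iff (v := ⟨s, hs⟩) (w := ⟨t, ht⟩)

end Deck

/-- Every vertex has exactly three neighbours. -/
def Reg (G : SimpleGraph V) : Prop := ∀ v, (G.neighborSet v).ncard = 3

lemma Reg.of_iso {H : SimpleGraph W} (h : Reg G) (f : H ≃g G) : Reg H := by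
  intro w
  rw [← h (f w), ← Set.ncard_image_of_injective _ f.injective]
  congr 1
  ext x
  constructor
  · rintro ⟨y, hy, rfl⟩
    exact f.map_adj_iff.2 hy
  · intro hx
    refine ⟨f.symm x, ?_, by simp⟩
    rw [mem_neighborSet, ← f.map_adj_iff]
    simpa using hx

/-- `G` and `H` differ only in how the pair `u`, `v` is attached to the other vertices, in a
way that does not alter the number of neighbours of a vertex in `{u, v}`. -/
structure AgreeOff (G H : SimpleGraph V) (u v : V) : Prop where
  ne : u ≠ v
  off : ∀ s t, s ≠ u → s ≠ v → t ≠ u → t ≠ v → (H.Adj s t ↔ G.Adj s t)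
  uv : H.Adj u v ↔ G.Adj u v
  and : ∀ w, w ≠ u → w ≠ v → (H.Adj u w ∧ H.Adj v w ↔ G.Adj u w ∧ G.Adj v w)
  or : ∀ w, w ≠ u → w ≠ v → (H.Adj u w ∨ H.Adj v w ↔ G.Adj u w ∨ G.Adj v w)

lemma agreeOff [Finite V] (hG : Reg G) (hH : Reg H) (huv : u ≠ v)
    (hoff : ∀ s t, s ≠ u → s ≠ v → t ≠ u → t ≠ v → (H.Adj s t ↔ G.Adj s t)) :
    AgreeOff G H u v := by
  classical
  have := Fintype.ofFinite V
  have hsum (K : SimpleGraph V) (hK : Reg K) (w : V) :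
      (if K.Adj w u then 1 else 0) + (if K.Adj w v then 1 else 0) +
        ∑ t ∈ ({u, v} : Finset V)ᶜ, (if K.Adj w t then 1 else 0) = 3 := by
    rw [← Finset.sum_pair (f := fun t ↦ if K.Adj w t then 1 else 0) huv, Finset.sum_add_sum_compl,
      ← hK w, Set.ncard_eq_toFinset_card', ← Finset.card_filter]
    congr 1
    ext x
    simp
  have hpair (w : V) (h1 : w ≠ u) (h2 : w ≠ v) :
      (if H.Adj u w then 1 else 0) + (if H.Adj v w then 1 else 0) =
        (if G.Adj u w then 1 else 0) + (if G.Adj v w then 1 else 0) := by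
    have h3 := hsum G hG w
    rw [← hsum H hH w] at h3
    have : ∑ t ∈ ({u, v} : Finset V)ᶜ, (if H.Adj w t then 1 else 0) =
        ∑ t ∈ ({u, v} : Finset V)ᶜ, (if G.Adj w t then 1 else 0) := by
      refine Finset.sum_congr rfl fun t ht ↦ ?_
      simp only [Finset.mem_compl, Finset.mem_insert, Finset.mem_singleton, not_or] at ht
      simp only [hoff w t h1 h2 ht.1 ht.2]
    simp only [adj_comm _ w u, adj_comm _ w v] at h3
    lia
  have huv' : H.Adj u v ↔ G.Adj u v := by
    have e1 := hsum G hG u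
    have e2 := hsum G hG v
    have e3 := hsum H hH u
    have e4 := hsum H hH v
    have : ∑ t ∈ ({u, v} : Finset V)ᶜ,
          ((if H.Adj u t then 1 else 0) + (if H.Adj v t then 1 else 0)) =
        ∑ t ∈ ({u, v} : Finset V)ᶜ,
          ((if G.Adj u t then 1 else 0) + (if G.Adj v t then 1 else 0)) := by
      refine Finset.sum_congr rfl fun t ht ↦ ?_
      simp only [Finset.mem_compl, Finset.mem_insert, Finset.mem_singleton, not_or] at ht
      exact hpair t ht.1 ht.2
    simp only [Finset.sum_add_distrib] at this
    simp only [SimpleGraph.irrefl, if_false, adj_comm _ v u] at e1 e2 e3 e4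
    by_cases h1 : G.Adj u v <;> by_cases h2 : H.Adj u v <;>
      simp only [h1, h2, if_true, if_false] at * <;> lia
  refine ⟨huv, hoff, huv', fun w h1 h2 ↦ ?_, fun w h1 h2 ↦ ?_⟩ <;>
  · have := hpair w h1 h2
    grind

/-- `H` arises from `G` by replacing the edges `uα` and `vβ` by `uβ` and `vα`. -/
structure Sw (G H : SimpleGraph V) (u v α β : V) : Prop where
  ne : u ≠ v
  off : ∀ s t, s ≠ u → s ≠ v → t ≠ u → t ≠ v → (H.Adj s t ↔ G.Adj s t)
  uv : H.Adj u v ↔ G.Adj u v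
  left : ∀ w, w ≠ v → (H.Adj u w ↔ (G.Adj u w ∧ w ≠ α) ∨ w = β)
  right : ∀ w, w ≠ u → (H.Adj v w ↔ (G.Adj v w ∧ w ≠ β) ∨ w = α)
  adj_left : G.Adj u α
  not_adj_left : ¬ G.Adj v α
  ne_left : α ≠ v
  adj_right : G.Adj v β
  not_adj_right : ¬ G.Adj u β
  ne_right : β ≠ u

lemma AgreeOff.sw (h : AgreeOff G H u v) {α β : V} (hα : G.neighborSet u \ H.neighborSet u = {α})
    (hβ : H.neighborSet u \ G.neighborSet u = {β}) : Sw G H u v α β := by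
  have h1 (w) : G.Adj u w ∧ ¬ H.Adj u w ↔ w = α := by
    simpa using Set.ext_iff.1 hα w
  have h2 (w) : H.Adj u w ∧ ¬ G.Adj u w ↔ w = β := by
    simpa using Set.ext_iff.1 hβ w
  obtain ⟨a1, a2⟩ := (h1 α).2 rfl
  obtain ⟨b1, b2⟩ := (h2 β).2 rfl
  have hαv : α ≠ v := by rintro rfl; exact a2 (h.uv.2 a1)
  have hβv : β ≠ v := by rintro rfl; exact b2 (h.uv.1 b1)
  have h3 := h.and α a1.ne' hαv
  have h4 := h.or α a1.ne' hαv
  have h5 := h.and β b1.ne' hβv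
  have h6 := h.or β b1.ne' hβv
  refine ⟨h.ne, h.off, h.uv, fun w hw ↦ ?_, fun w hw ↦ ?_, a1, by tauto, hαv, by tauto, b2, b1.ne'⟩
  · grind
  · by_cases hwv : w = v
    · subst hwv; simp [hαv.symm]
    · grind [h.and w hw hwv, h.or w hw hwv]

lemma comap_swap_left [DecidableEq V] {w : V} (hu : w ≠ u) (hv : w ≠ v) :
    (H.comap (Equiv.swap u v)).Adj u w ↔ H.Adj v w := by
  simp [Equiv.swap_apply_of_ne_of_ne hu hv]

lemma comap_swap_right [DecidableEq V] {w : V} (hu : w ≠ u) (hv : w ≠ v) :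
    (H.comap (Equiv.swap u v)).Adj v w ↔ H.Adj u w := by
  simp [Equiv.swap_apply_of_ne_of_ne hu hv]

lemma AgreeOff.flip [DecidableEq V] (h : AgreeOff G H u v) :
    AgreeOff G (H.comap (Equiv.swap u v)) u v := by
  refine ⟨h.ne, fun s t h1 h2 h3 h4 ↦ ?_, ?_, fun w h1 h2 ↦ ?_, fun w h1 h2 ↦ ?_⟩
  · rw [← h.off s t h1 h2 h3 h4]
    simp [Equiv.swap_apply_of_ne_of_ne, *]
  · rw [← h.uv]
    simp [adj_comm]
  · rw [comap_swap_left h1 h2, comap_swap_right h1 h2, and_comm, h.and w h1 h2]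
  · rw [comap_swap_left h1 h2, comap_swap_right h1 h2, or_comm, h.or w h1 h2]

lemma AgreeOff.ext [Finite V] (h : AgreeOff G H u v) (hG : Reg G) (hH : Reg H)
    (hu : ∀ w, w ≠ u → w ≠ v → G.Adj u w → H.Adj u w) : H = G := by
  have hsub : G.neighborSet u ⊆ H.neighborSet u := by
    intro w hw
    by_cases hwv : w = v
    · subst hwv
      exact h.uv.2 hw
    · exact hu w (Adj.ne' hw) hwv hw
  have heq := Set.eq_of_subset_of_ncard_le hsub (by rw [hG, hH])
  have h1 : ∀ w, H.Adj u w ↔ G.Adj u w := fun w ↦ (Set.ext_iff.1 heq w).symm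
  have h2 : ∀ w, H.Adj v w ↔ G.Adj v w := by
    intro w
    by_cases hwu : w = u
    · rw [hwu, adj_comm, h1, adj_comm]
    by_cases hwv : w = v
    · simp [hwv]
    have := h.and w hwu hwv
    have := h.or w hwu hwv
    have := h1 w
    tauto
  ext s t
  by_cases hs : s = u
  · rw [hs, h1]
  by_cases hs' : s = v
  · rw [hs', h2]
  by_cases ht : t = u
  · rw [ht, adj_comm, h1, adj_comm]
  by_cases ht' : t = v
  · rw [ht', adj_comm, h2, adj_comm]
  exact h.off s t hs hs' ht ht'

lemma AgreeOff.exists_sw_of_ncard [Finite V] (hG : Reg G) (hH : Reg H) (h : AgreeOff G H u v)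
    (hone : (G.neighborSet u \ H.neighborSet u).ncard = 1) : ∃ α β, Sw G H u v α β := by
  obtain ⟨α, hα⟩ := Set.ncard_eq_one.1 hone
  have := Set.ncard_inter_add_ncard_sdiff_eq_ncard (G.neighborSet u) (H.neighborSet u)
  have h2 := Set.ncard_inter_add_ncard_sdiff_eq_ncard (H.neighborSet u) (G.neighborSet u)
  rw [Set.inter_comm, hH, ← hG u, ← this, add_right_inj, hone] at h2
  obtain ⟨β, hβ⟩ := Set.ncard_eq_one.1 h2
  exact ⟨α, β, h.sw hα hβ⟩

lemma AgreeOff.exists_sw [Finite V] [DecidableEq V] (hG : Reg G) (hH : Reg H)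
    (h : AgreeOff G H u v) (hiso : ¬ Nonempty (H ≃g G)) :
    ∃ K, Nonempty (K ≃g H) ∧ ∃ α β γ, Sw G K u v α β ∧ γ ≠ α ∧ G.Adj u γ ∧ ¬ G.Adj v γ ∧ γ ≠ v := by
  let H' := H.comap (Equiv.swap u v)
  have hi' : H' ≃g H := Iso.comap _ _
  have hH' : Reg H' := hH.of_iso hi'
  have hf : AgreeOff G H' u v := h.flip
  have hadj (w : V) (h1 : w ≠ u) (h2 : w ≠ v) : H'.Adj u w ↔ H.Adj v w := comap_swap_left h1 h2
  obtain ⟨γ, g1, g2, g3, g4⟩ : ∃ γ, G.Adj u γ ∧ ¬ G.Adj v γ ∧ γ ≠ v ∧ H.Adj u γ := by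
    by_contra! hcon
    refine hiso ⟨hi'.symm.trans ?_⟩
    rw [hf.ext hG hH' fun w h1 h2 h3 ↦ (hadj w h1 h2).2 (by grind [h.and w h1 h2, h.or w h1 h2])]
  obtain ⟨α, a1, a2⟩ : ∃ α, G.Adj u α ∧ ¬ H.Adj u α := by
    by_contra! hcon
    refine hiso ?_
    rw [h.ext hG hH fun w _ _ h3 ↦ hcon _ h3]
    exact ⟨Iso.refl⟩
  have hαv : α ≠ v := by rintro rfl; exact a2 (h.uv.2 a1)
  have hαγ : γ ≠ α := by rintro rfl; exact a2 g4
  have a3 : ¬ G.Adj v α := by grind [h.and α a1.ne' hαv, h.or α a1.ne' hαv]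
  obtain ⟨δ, hd⟩ : ∃ δ, G.neighborSet u = {γ, α, δ} := by
    obtain ⟨p, q, r, h1, h2, h3, h4⟩ := Set.ncard_eq_three.1 (hG u)
    have : γ ∈ G.neighborSet u := g1
    have : α ∈ G.neighborSet u := a1
    rw [h4] at *
    have hperm : ∀ δ, ({p, q, r} : Set V) = {γ, α, δ} ↔
      ∀ x, (x = p ∨ x = q ∨ x = r) ↔ (x = γ ∨ x = α ∨ x = δ) := fun δ ↦ by simp [Set.ext_iff]
    simp only [hperm]
    simp only [Set.mem_insert_iff, Set.mem_singleton_iff] at *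
    by_cases hp : p = γ ∨ p = α <;> by_cases hq : q = γ ∨ q = α
    exacts [⟨r, by grind⟩, ⟨q, by grind⟩, ⟨p, by grind⟩, ⟨r, by grind⟩]
  by_cases hδ : H.Adj u δ
  · obtain ⟨α', β, hs⟩ := h.exists_sw_of_ncard hG hH (Set.ncard_eq_one.2 ⟨α, by
      ext x; rw [hd]; simp; grind⟩)
    have : α' = α := by
      have h3 := hs.left α' hs.ne_left
      have h4 : α' ∈ G.neighborSet u := hs.adj_left
      rw [hd] at h4
      grind [hs.adj_right, hs.not_adj_left]
    exact ⟨H, ⟨Iso.refl⟩, α, β, γ, this ▸ hs, hαγ, g1, g2, g3⟩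
  · have hγ' : ¬ H'.Adj u γ := by
      rw [hadj γ g1.ne' g3]; grind [h.and γ g1.ne' g3]
    have hα' : H'.Adj u α := by
      rw [hadj α a1.ne' hαv]; grind [h.or α a1.ne' hαv]
    have d1 : G.Adj u δ := by
      have : δ ∈ G.neighborSet u := by rw [hd]; simp
      exact this
    have hδv : δ ≠ v := by rintro rfl; exact hδ (h.uv.2 d1)
    have hδ' : H'.Adj u δ := by
      rw [hadj δ d1.ne' hδv]; grind [h.or δ d1.ne' hδv]
    obtain ⟨α', β, hs⟩ := hf.exists_sw_of_ncard hG hH' (Set.ncard_eq_one.2 ⟨γ, by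
      ext x; rw [hd]; simp only [Set.mem_sdiff, Set.mem_insert_iff, Set.mem_singleton_iff,
        mem_neighborSet]; grind⟩)
    have : α' = γ := by
      have h3 := hs.left α' hs.ne_left
      have h4 : α' ∈ G.neighborSet u := hs.adj_left
      rw [hd] at h4
      grind [hs.adj_right, hs.not_adj_left]
    exact ⟨H', ⟨hi'⟩, γ, β, α, this ▸ hs, hαγ.symm, a1, a3, hαv⟩

lemma Sw.flip [DecidableEq V] {α β γ δ : V} (h : Sw G H u v α β)
    (hu : ∀ w, w ≠ v → (G.Adj u w ↔ w = α ∨ w = γ))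
    (hv : ∀ w, w ≠ u → (G.Adj v w ↔ w = β ∨ w = δ)) (hαγ : α ≠ γ) (hβδ : β ≠ δ)
    (hγv : γ ≠ v) (hδu : δ ≠ u) (hγδ : γ ≠ δ) :
    Sw G (H.comap (Equiv.swap u v)) u v γ δ := by
  have e1 := h.adj_left.ne
  have e2 := h.adj_right.ne
  have e3 := hu γ hγv
  have e4 := hv δ hδu
  simp only [or_true, iff_true] at e3 e4
  have e5 := h.not_adj_left
  have e6 := h.not_adj_right
  have e7 : ¬ G.Adj v γ := by grind [hv γ e3.ne']
  have e8 : ¬ G.Adj u δ := by grind [hu δ e4.ne']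
  have e9 := h.ne_left
  have e0 := h.ne_right
  refine ⟨h.ne, fun s t h1 h2 h3 h4 ↦ ?_, ?_, fun w hw ↦ ?_, fun w hw ↦ ?_, e3, e7, hγv, e4,
    e8, hδu⟩
  · rw [← h.off s t h1 h2 h3 h4]
    simp [Equiv.swap_apply_of_ne_of_ne, *]
  · rw [← h.uv]
    simp [adj_comm]
  · by_cases hwu : w = u
    · subst hwu; simp [hδu.symm]
    · rw [comap_swap_left hwu hw, h.right w hwu, hv w hwu, hu w hw]
      grind
  · by_cases hwv : w = v
    · subst hwv; simp [hγv.symm]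
    · rw [comap_swap_right hw hwv, h.left w hwv, hv w hw, hu w hwv]
      grind

section Partner

variable [Fintype V] [DecidableEq V]

/-- `G` and `H` are non-isomorphic cubic graphs of girth at least `g` with the same
`(n-2)`-deck. -/
structure Partner (g : ℕ) (G H : SimpleGraph V) : Prop where
  reg : Reg G
  reg' : Reg H
  girth : (g : ℕ∞) ≤ G.egirth
  girth' : (g : ℕ∞) ≤ H.egirth
  deck : SameDeck G H (Fintype.card V - 2)
  not_iso : ¬ Nonempty (H ≃g G)

lemma Partner.symm (h : Partner g G H) : Partner g H G :=
  ⟨h.reg', h.reg, h.girth', h.girth, sameDeck_symm h.deck, fun ⟨f⟩ ↦ h.not_iso ⟨f.symm⟩⟩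

lemma Partner.of_iso (h : Partner g G H) (f : K ≃g H) : Partner g G K :=
  ⟨h.reg, h.reg'.of_iso f, h.girth, f.egirth_eq ▸ h.girth', sameDeck_of_iso h.deck f.symm,
    fun ⟨i⟩ ↦ h.not_iso ⟨f.symm.trans i⟩⟩

lemma Partner.exists_sw (h : Partner g G H) (huv : u ≠ v) : ∃ K, Partner g G K ∧
    ∃ α β γ, Sw G K u v α β ∧ γ ≠ α ∧ G.Adj u γ ∧ ¬ G.Adj v γ ∧ γ ≠ v := by
  obtain ⟨H', ⟨f⟩, hoff⟩ := exists_iso_agree h.deck huv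
  have h' := h.of_iso f
  obtain ⟨K, ⟨i⟩, hK⟩ := (agreeOff h'.reg h'.reg' huv hoff).exists_sw h'.reg h'.reg' h'.not_iso
  exact ⟨K, h'.of_iso i, hK⟩

end Partner

lemma Reg.eq_or (h : Reg G) {a b c w : V} (ha : G.Adj u a) (hb : G.Adj u b) (hc : G.Adj u c)
    (hab : a ≠ b) (hac : a ≠ c) (hbc : b ≠ c) (hw : G.Adj u w) : w = a ∨ w = b ∨ w = c := by
  obtain ⟨p, q, r, h1, h2, h3, h4⟩ := Set.ncard_eq_three.1 (h u)
  have hu : ∀ x, G.Adj u x ↔ x = p ∨ x = q ∨ x = r := by simpa [Set.ext_iff] using h4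
  simp only [hu] at *
  grind

lemma Reg.exists_third (h : Reg G) (a b : V) : ∃ c, G.Adj u c ∧ c ≠ a ∧ c ≠ b := by
  obtain ⟨p, q, r, h1, h2, h3, h4⟩ := Set.ncard_eq_three.1 (h u)
  have hu : ∀ x, G.Adj u x ↔ x = p ∨ x = q ∨ x = r := by simpa [Set.ext_iff] using h4
  simp only [hu]
  by_cases p = a ∨ p = b <;> by_cases q = a ∨ q = b
  exacts [⟨r, by grind⟩, ⟨q, by grind⟩, ⟨p, by grind⟩, ⟨p, by grind⟩]

lemma not_isAcyclic [Finite V] [Nonempty V]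
    (h : ∀ v, ∃ a b, G.Adj v a ∧ G.Adj v b ∧ a ≠ b) : ¬ G.IsAcyclic := by
  intro hac
  have := Fintype.ofFinite V
  have (n : ℕ) : ∃ u v, ∃ p : G.Walk u v, p.IsPath ∧ p.length = n := by
    induction n with
    | zero => exact ⟨Classical.arbitrary V, _, .nil, by simp⟩
    | succ n ih =>
      obtain ⟨u, v, p, hp, hn⟩ := ih
      obtain ⟨a, b, ha, hb, hab⟩ := h u
      obtain ⟨c, hc, hcp⟩ : ∃ c, G.Adj u c ∧ c ∉ p.support := by
        by_contra! hcon
        have h1 := hac.eq_snd_of_adj_start hp ha (hcon a ha)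
        have h2 := hac.eq_snd_of_adj_start hp hb (hcon b hb)
        exact hab (h1.trans h2.symm)
      exact ⟨c, v, .cons hc.symm p, hp.cons hcp, by simp [hn]⟩
  obtain ⟨u, v, p, hp, hn⟩ := this (Fintype.card V)
  exact hn.not_lt hp.length_lt

/-- `S` is a set of `g` vertices inducing a subgraph of minimum degree at least two. -/
def IsF (g : ℕ) (G : SimpleGraph V) (S : Finset V) : Prop :=
  S.card = g ∧ ∀ v ∈ S, ∃ a ∈ S, ∃ b ∈ S, G.Adj v a ∧ G.Adj v b ∧ a ≠ b

lemma IsF.exists_winds {S : Finset V} (hG : (g : ℕ∞) ≤ G.egirth) (hg : 0 < g) (h : IsF g G S) :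
    ∃ p, Winds g G p ∧ ∀ z, z ∈ S ↔ ∃ i, p i = z := by
  classical
  have hne : Nonempty (S : Set V) := by
    obtain ⟨x, hx⟩ := Finset.card_pos.1 (h.1 ▸ hg)
    exact ⟨⟨x, hx⟩⟩
  have hac : ¬ (G.induce (S : Set V)).IsAcyclic := by
    refine not_isAcyclic fun ⟨x, hx⟩ ↦ ?_
    obtain ⟨a, ha, b, hb, h1, h2, h3⟩ := h.2 x hx
    exact ⟨⟨a, ha⟩, ⟨b, hb⟩, h1, h2, by simpa using h3⟩
  simp only [IsAcyclic, not_forall, not_not] at hac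
  obtain ⟨x, c, hc⟩ := hac
  have hle : c.length ≤ g := by
    have h1 := hc.support_nodup.length_le_card
    rw [← h.1]
    simpa using h1
  obtain ⟨x, c, hc, hle, hS⟩ : ∃ x, ∃ c : G.Walk x x, c.IsCycle ∧ c.length ≤ g ∧
      ∀ z ∈ c.support, z ∈ S := by
    refine ⟨_, c.map (Embedding.induce (S : Set V)).toHom, hc.map Subtype.val_injective,
      (c.length_map _).trans_le hle, fun z hz ↦ ?_⟩
    rw [Walk.support_map, List.mem_map] at hz
    obtain ⟨y, -, rfl⟩ := hz
    exact y.2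
  have hge : g ≤ c.length := by exact_mod_cast hG.trans (egirth_le_length hc)
  obtain ⟨p, hp, hs, -⟩ := exists_winds_of_isCycle c hc (hle.antisymm hge)
  refine ⟨p, hp, fun z ↦ ?_⟩
  rw [← hs]
  refine ⟨fun hz ↦ ?_, hS z⟩
  have hsub : c.support.tail.toFinset ⊆ S :=
    fun y hy ↦ hS y (List.mem_of_mem_tail (List.mem_toFinset.1 hy))
  have heq := Finset.eq_of_subset_of_card_le hsub (by
    rw [List.toFinset_card_of_nodup hc.support_nodup, h.1]
    simpa using hge)
  rw [← heq, List.mem_toFinset] at hz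
  exact List.mem_of_mem_tail hz

lemma IsF.exists_oriented {S : Finset V} (hG : (g : ℕ∞) ≤ G.egirth) (hg : 0 < g) (h : IsF g G S)
    {z w : V} (hz : z ∈ S) (hw : w ∈ S) (hadj : G.Adj z w) :
    ∃ p, Winds g G p ∧ (∀ z, z ∈ S ↔ ∃ i, p i = z) ∧ p 0 = z ∧ p 1 = w := by
  obtain ⟨p, hp, hSp⟩ := h.exists_winds hG hg
  obtain ⟨q, hq, h0, h1, hqp, -⟩ := hp.exists_oriented hG hg ((hSp z).1 hz) ((hSp w).1 hw) hadj
  exact ⟨q, hq, fun v ↦ by rw [hSp, hqp], h0, h1⟩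

open Classical in
/-- The vertices of a closed winding. -/
noncomputable def range (g : ℕ) (p : ℤ → V) : Finset V := (Finset.Ico 0 (g : ℤ)).image p

lemma Winds.mem_range {p : ℤ → V} (h : Winds g G p) (hg : 0 < g) {z : V} :
    z ∈ range g p ↔ ∃ i, p i = z := by
  simp only [range, Finset.mem_image, Finset.mem_Ico]
  constructor
  · rintro ⟨i, -, hi⟩
    exact ⟨i, hi⟩
  · rintro ⟨i, rfl⟩
    obtain ⟨j, h1, h2, h3⟩ := h.exists_index hg i 0
    exact ⟨j, ⟨h1, by lia⟩, h3⟩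

lemma Winds.isF_range {p : ℤ → V} (h : Winds g G p) (hg : 3 ≤ g) : IsF g G (range g p) := by
  classical
  refine ⟨?_, fun v hv ↦ ?_⟩
  · rw [range, Finset.card_image_of_injOn]
    · simp
    · intro i hi j hj hij
      simp only [Finset.coe_Ico, Set.mem_Ico] at hi hj
      rcases lt_trichotomy i j with hlt | heq | hlt
      exacts [(h.ne hlt (by lia) hij).elim, heq, (h.ne' hlt (by lia) hij).elim]
  · obtain ⟨i, rfl⟩ := (h.mem_range (by lia)).1 hv
    exact ⟨p (i + 1), (h.mem_range (by lia)).2 ⟨_, rfl⟩, p (i - 1),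
      (h.mem_range (by lia)).2 ⟨_, rfl⟩, h.adj i, (h.adj' (by lia)).symm, h.ne' (by lia) (by lia)⟩

section Deck

variable [Fintype V] [DecidableEq V]

lemma le_egirth_of_sameDeck (h : SameDeck G H (Fintype.card V - 2))
    (hn : g + 1 ≤ Fintype.card V) (hG : (g : ℕ∞) ≤ G.egirth) : (g : ℕ∞) ≤ H.egirth := by
  rw [le_egirth]
  intro a c hc
  by_contra! hlt
  have hlt : c.length < g := by simpa using hlt
  have hcard : c.support.toFinset.card ≤ Fintype.card V - 2 := by
    refine le_trans ?_ (show c.length ≤ Fintype.card V - 2 by lia)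
    have : c.support.toFinset ⊆ c.support.tail.toFinset := by
      intro z hz
      rw [List.mem_toFinset, Walk.mem_support_iff] at *
      rcases hz with rfl | hz
      · exact Walk.end_mem_tail_support hc.not_nil
      · exact hz
    refine (Finset.card_le_card this).trans ((List.toFinset_card_le _).trans ?_)
    simp
  obtain ⟨S, hS, hS'⟩ := Finset.exists_superset_card_eq hcard (Nat.sub_le _ _)
  obtain ⟨e, he⟩ := sameDeck_symm h
  obtain ⟨f⟩ := he ⟨S, hS'⟩
  have hw : ∀ z ∈ c.support, z ∈ (S : Set V) := fun z hz ↦ hS (List.mem_toFinset.2 hz)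
  have hc' : (c.induce _ hw).IsCycle := by
    refine Walk.IsCycle.of_map (f := (Embedding.induce (S : Set V)).toHom) ?_
    rwa [Walk.map_induce]
  have h1 := egirth_le_length (hc'.map (f := (Embedding.induce _).toHom.comp f.toHom)
    (Subtype.val_injective.comp f.injective))
  have h2 := hG.trans h1
  rw [Walk.length_map, ← Walk.length_map (f := (Embedding.induce (S : Set V)).toHom),
    Walk.map_induce] at h2
  have h3 : g ≤ c.length := by exact_mod_cast h2
  lia

lemma Partner.not_two (h : Partner g G H) {s t : V} (huv : u ≠ v) (hs : G.Adj u s)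
    (ht : G.Adj u t) (hst : s ≠ t) (hs' : s = v ∨ G.Adj v s) (ht' : t = v ∨ G.Adj v t) : False := by
  obtain ⟨K, -, α, β, γ, hS, h1, h2, h3, h4⟩ := h.exists_sw huv
  have := h.reg.eq_or hs ht hS.adj_left hst (by rintro rfl; grind [hS.ne_left, hS.not_adj_left])
    (by rintro rfl; grind [hS.ne_left, hS.not_adj_left]) h2
  grind

lemma Partner.five_le (h : Partner 3 G H) (hgirth : G.egirth = g) : 5 ≤ g ∧
    g + 2 ≤ Fintype.card V ∧ Partner g G H := by
  have hac : ¬ G.IsAcyclic := by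
    rw [← egirth_eq_top, hgirth]; simp
  obtain ⟨x, c, hc, hl⟩ := exists_egirth_eq_length.2 hac
  rw [hgirth] at hl
  have hl : g = c.length := by exact_mod_cast hl
  obtain ⟨p, hp, -, -⟩ := exists_winds_of_isCycle c hc hl.symm
  have h3 := hc.three_le_length
  have a0 := hp.adj 0
  have a1 : G.Adj (p 0) (p (-1)) := (hp.adj' (by lia)).symm
  have h5 : 5 ≤ g := by
    by_contra! hlt
    obtain h4 | h4 : g = 3 ∨ g = 4 := by lia
    · refine h.not_two (u := p 0) (v := p 1) (hp.ne (by lia) (by lia)) a0 a1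
        (hp.ne' (by lia) (by lia)) (.inl rfl) (.inr ?_)
      rw [← hp.add (-1)]
      exact hp.adj' (by lia)
    · refine h.not_two (u := p 0) (v := p 2) (hp.ne (by lia) (by lia)) a0 a1
        (hp.ne' (by lia) (by lia)) (.inr (hp.adj' (by lia)).symm) (.inr ?_)
      rw [← hp.add (-1)]
      exact hp.adj' (by lia)
  obtain ⟨s, s1, s2, s3⟩ := h.reg.exists_third (u := p 0) (p 1) (p (-1))
  obtain ⟨t, t1, t2, t3⟩ := h.reg.exists_third (u := p 1) (p 2) (p 0)
  have hst : s ≠ t := by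
    rintro rfl
    exact h.not_two a0.ne a0 s1 s2.symm (.inl rfl) (.inr t1)
  have hs : s ∉ range g p := by
    rw [hp.mem_range (by lia)]
    rintro ⟨k, rfl⟩
    rcases hp.chordless hgirth.ge (by lia) s1 with h | h
    exacts [s2 h, s3 h]
  have ht : t ∉ range g p := by
    rw [hp.mem_range (by lia)]
    rintro ⟨k, rfl⟩
    rcases hp.chordless hgirth.ge (by lia) t1 with h | h
    exacts [t2 h, t3 h]
  have hn : g + 2 ≤ Fintype.card V := by
    have := Finset.card_le_univ (insert s (insert t (range g p)))
    rw [Finset.card_insert_of_notMem (by simp [hst, hs]), Finset.card_insert_of_notMem ht,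
      (hp.isF_range (by lia)).1] at this
    exact this
  exact ⟨h5, hn, h.reg, h.reg', hgirth.ge, le_egirth_of_sameDeck h.deck (by lia) hgirth.ge,
    h.deck, h.not_iso⟩

end Deck

lemma Sw.symm {α β : V} (h : Sw G H u v α β) : Sw H G u v β α where
  ne := h.ne
  off s t h1 h2 h3 h4 := (h.off s t h1 h2 h3 h4).symm
  uv := h.uv.symm
  left w hw := by
    grind [h.left w hw, h.adj_left, h.not_adj_right]
  right w hw := by
    grind [h.right w hw, h.adj_right, h.not_adj_left]
  adj_left := (h.left β h.adj_right.ne').2 (.inr rfl)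
  not_adj_left := by
    grind [h.right β h.ne_right, h.adj_left, h.not_adj_right]
  ne_left := h.adj_right.ne'
  adj_right := (h.right α h.adj_left.ne').2 (.inr rfl)
  not_adj_right := by
    grind [h.left α h.ne_left, h.adj_right, h.not_adj_left]
  ne_right := h.adj_left.ne'

lemma Sw.swap {α β : V} (h : Sw G H u v α β) : Sw G H v u β α where
  ne := h.ne.symm
  off s t h1 h2 h3 h4 := h.off s t h2 h1 h4 h3
  uv := by rw [H.adj_comm, G.adj_comm, h.uv]
  left := h.right
  right := h.left
  adj_left := h.adj_right
  not_adj_left := h.not_adj_right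
  ne_left := h.ne_right
  adj_right := h.adj_left
  not_adj_right := h.not_adj_left
  ne_right := h.ne_left

lemma Sw.transfer {α β : V} (h : Sw G H u v α β) {A : Set V} {k : ℤ} {p q : V}
    (hw : Avoids G A k p q) (hu : u ∈ A) (hv : v ∈ A) : Avoids H A k p q :=
  hw.transfer fun s t hs ht hst ↦ (h.off s t (by grind) (by grind) (by grind) (by grind)).2 hst

lemma Sw.not_isF {α β : V} (h : Sw G H u v α β) (hg : 3 ≤ g) (hG : (g : ℕ∞) ≤ G.egirth)
    (hH : (g : ℕ∞) ≤ H.egirth) {S : Finset V} (hS : IsF g G S) (hu : u ∈ S) (hα : α ∈ S)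
    (hv : v ∉ S) : ¬ IsF g H S := by
  intro hS'
  obtain ⟨p, hp, hSp, hp0, hp1⟩ : ∃ p, Winds g G p ∧ (∀ z, z ∈ S ↔ ∃ i, p i = z) ∧
      p 0 = u ∧ p (-1) = α := by
    obtain ⟨p, hp, hSp, h0, h1⟩ := hS.exists_oriented hG (by lia) hα hu h.adj_left.symm
    refine ⟨_, hp.shift 1, fun z ↦ ?_, by simpa using h1, by simpa using h0⟩
    rw [hSp]
    exact ⟨fun ⟨j, hj⟩ ↦ ⟨j - 1, by simpa using hj⟩, fun ⟨j, hj⟩ ↦ ⟨_, hj⟩⟩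
  have hnb (w : V) (hw : w ∈ S) (hwu : H.Adj u w) : w = p 1 ∨ w = β := by
    obtain ⟨k, rfl⟩ := (hSp w).1 hw
    rw [h.left _ (by grind)] at hwu
    rcases hwu with ⟨h1, h2⟩ | h1
    · rw [← hp0] at h1
      rcases hp.chordless hG (by lia) h1 with h3 | h3
      · exact .inl h3
      · exact (h2 (by rw [h3, ← hp1]; congr 1)).elim
    · exact .inr h1
  obtain ⟨hβ, h1⟩ : β ∈ S ∧ H.Adj u (p 1) := by
    obtain ⟨a, ha, b, hb, h1, h2, h3⟩ := hS'.2 u hu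
    grind
  have hpv (i : ℤ) : p i ≠ v := by rintro rfl; exact hv ((hSp _).2 ⟨_, rfl⟩)
  obtain ⟨k, hk⟩ := (hSp β).1 hβ
  obtain ⟨j, j1, j2, j3⟩ := hp.exists_index_ne (k := k) (i := 0) (by lia)
    (by rw [hk, hp0]; exact h.ne_right)
  rw [hk] at j3
  have hβ1 : p 1 ≠ β := by
    intro he
    refine h.not_adj_right ?_
    rw [← hp0, ← he]
    exact hp.adj' (by lia)
  have j4 : j ≠ 1 := by rintro rfl; exact hβ1 j3
  have j5 : j ≠ g - 1 := by
    rintro rfl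
    rw [show (g : ℤ) - 1 = -1 + g by ring, hp.add, hp1] at j3
    exact h.not_adj_right (j3 ▸ h.adj_left)
  have := le_of_avoids hH (A := {u, v}) (by simp) (h.transfer (hp.avoids (i := 1) (j := j)
    (by lia) le_rfl (A := {u, v}) (fun l hl hl' ↦ by
      simpa [hpv, ← hp0] using hp.ne' (by lia) (by lia))) (by simp) (by simp)) h1
    (j3 ▸ h.symm.adj_left) (j3 ▸ hβ1)
  lia

lemma Sw.mem_of_isF {α β : V} (h : Sw G H u v α β) (hg : 3 ≤ g) (hG : (g : ℕ∞) ≤ G.egirth)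
    (hH : (g : ℕ∞) ≤ H.egirth) {S : Finset V} (hS : IsF g H S) (hu : u ∈ S)
    (hv : v ∈ S) (hβ : β ∈ S) : α ∈ S := by
  by_contra hα
  obtain ⟨p, hp, hSp, hp0, hp1⟩ := hS.exists_oriented hH (by lia) hu hβ h.symm.adj_left
  obtain ⟨k, hk⟩ := (hSp v).1 hv
  obtain ⟨j, j1, j2, j3⟩ := hp.exists_index_ne (k := k) (i := 0) (by lia)
    (by rw [hk, hp0]; exact h.ne.symm)
  rw [hk] at j3
  have j4 : j ≠ 1 := by rintro rfl; exact h.adj_right.ne (j3.symm.trans hp1)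
  have hvj : H.Adj v (p (j - 1)) := j3 ▸ (hp.adj' (by lia)).symm
  have hj : p (j - 1) ≠ β := by
    intro he
    exact h.symm.not_adj_left (he ▸ hvj)
  have hju : p (j - 1) ≠ u := hp0 ▸ hp.ne' (by lia) (by lia)
  have hvj' : G.Adj v (p (j - 1)) := by
    rw [h.right _ hju] at hvj
    rcases hvj with h1 | h1
    · exact h1.1
    · exact (hα ((hSp α).2 ⟨_, h1⟩)).elim
  have := hp.avoids (i := 1) (j := j - 1) (A := {u, v})
    (by lia) le_rfl (fun l hl hl' ↦ by
      simp only [← hp0, ← j3, Set.mem_insert_iff, Set.mem_singleton_iff, not_or]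
      exact ⟨hp.ne' (by lia) (by lia), hp.ne (by lia) (by lia)⟩)
  have := le_of_avoids hG (A := {u, v}) (u := v) (by simp)
    (h.symm.transfer this (by simp) (by simp)) (hp1 ▸ h.adj_right) hvj' (hp1 ▸ hj.symm)
  lia

lemma Sw.gained {α β : V} (h : Sw G H u v α β) (hg : 3 ≤ g) (hG : (g : ℕ∞) ≤ G.egirth)
    (hH : (g : ℕ∞) ≤ H.egirth) {S : Finset V} (hS : IsF g H S) (hS' : ¬ IsF g G S) :
    (u ∈ S ∧ v ∉ S ∧ β ∈ S) ∨ (v ∈ S ∧ u ∉ S ∧ α ∈ S) := by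
  have hmono (hm : ∀ w ∈ S, ∀ z ∈ S, H.Adj w z → G.Adj w z) : False := by
    refine hS' ⟨hS.1, fun w hw ↦ ?_⟩
    obtain ⟨a, ha, b, hb, h1, h2, h3⟩ := hS.2 w hw
    exact ⟨a, ha, b, hb, hm w hw a ha h1, hm w hw b hb h2, h3⟩
  have hl (w z : V) (hz : H.Adj w z) : G.Adj w z ∨ (w = u ∧ z = β) ∨ (w = β ∧ z = u) ∨
      (w = v ∧ z = α) ∨ (w = α ∧ z = v) := by
    by_cases hw : w = u
    · subst hw
      by_cases hzv : z = v
      · subst hzv; exact .inl (h.uv.1 hz)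
      grind [h.left z hzv]
    by_cases hw' : w = v
    · subst hw'
      by_cases hzv : z = u
      · subst hzv; exact .inl (h.uv.1 hz.symm).symm
      grind [h.right z hzv]
    by_cases hzu : z = u
    · subst hzu
      grind [h.left w hw', G.adj_comm, H.adj_comm]
    by_cases hzv : z = v
    · subst hzv
      grind [h.right w hw, G.adj_comm, H.adj_comm]
    exact .inl ((h.off w z hw hw' hzu hzv).1 hz)
  have a1 := h.adj_left
  have a2 := h.adj_right
  by_cases hu : u ∈ S <;> by_cases hv : v ∈ S
  · exfalso
    have hβα := h.mem_of_isF hg hG hH hS hu hv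
    have hαβ := h.swap.mem_of_isF hg hG hH hS hv hu
    by_cases hα : α ∈ S
    · have hβ := hαβ hα
      have b1 := h.symm.not_adj_left
      have b2 := h.symm.not_adj_right
      have b3 : α ≠ β := by rintro rfl; exact h.not_adj_left a2
      have b4 := h.ne
      have b5 := h.ne_left
      have b6 := h.ne_right
      have b7 := a1.ne
      have b8 := a2.ne
      refine hS' ⟨hS.1, fun w hw ↦ ?_⟩
      obtain ⟨a, ha, b, hb, h1, h2, h3⟩ := hS.2 w hw
      have key (s t : V) (hs : s ∈ S) (hn : G.Adj w s) (hns : ¬ H.Adj w s)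
          (ht : ∀ z, H.Adj w z → z ≠ t → G.Adj w z) :
          ∃ a ∈ S, ∃ b ∈ S, G.Adj w a ∧ G.Adj w b ∧ a ≠ b := by
        by_cases hat : a = t
        · exact ⟨s, hs, b, hb, hn, ht b h2 (hat ▸ h3.symm), by rintro rfl; exact hns h2⟩
        by_cases hbt : b = t
        · exact ⟨a, ha, s, hs, ht a h1 hat, hn, by rintro rfl; exact hns h1⟩
        exact ⟨a, ha, b, hb, ht a h1 hat, ht b h2 hbt, h3⟩
      by_cases hwu : w = u
      · subst hwu; exact key α β hα a1 b2 (fun z hz hzn ↦ by clear key hmono; grind [hl _ z hz])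
      by_cases hwv : w = v
      · subst hwv; exact key β α hβ a2 b1 (fun z hz hzn ↦ by clear key hmono; grind [hl _ z hz])
      by_cases hwα : w = α
      · subst hwα; exact key u v hu a1.symm (fun h ↦ b2 h.symm)
          (fun z hz hzn ↦ by clear key hmono; grind [hl _ z hz])
      by_cases hwβ : w = β
      · subst hwβ; exact key v u hv a2.symm (fun h ↦ b1 h.symm)
          (fun z hz hzn ↦ by clear key hmono; grind [hl _ z hz])
      exact ⟨a, ha, b, hb, by grind [hl _ a h1], by grind [hl _ b h2], h3⟩
    · exact hmono (by grind)
  · by_cases hβ : β ∈ S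
    · exact .inl ⟨hu, hv, hβ⟩
    · exact (hmono (by grind)).elim
  · by_cases hα : α ∈ S
    · exact .inr ⟨hv, hu, hα⟩
    · exact (hmono (by grind)).elim
  · exact (hmono (by grind)).elim

lemma Sw.right_eq_of_avoids {α β p q : V} {k : ℤ} (h : Sw G H u v α β)
    (hH : (g : ℕ∞) ≤ H.egirth) (hp : p = α) (hq : G.Adj v q) (hqu : q ≠ u)
    (hw : Avoids G {u, v} k p q) (hk : k + 3 ≤ g) : q = β := by
  by_contra hqβ
  have := le_of_avoids hH (u := v) (by simp) (h.transfer hw (by simp) (by simp))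
    (hp ▸ h.symm.adj_right) ((h.right q hqu).2 (.inl ⟨hq, hqβ⟩))
    (by rintro rfl; exact h.not_adj_left (hp ▸ hq))
  lia

lemma Sw.eq_iff_of_avoids {α β p q : V} {k : ℤ} (h : Sw G H u v α β)
    (hH : (g : ℕ∞) ≤ H.egirth) (hp : G.Adj u p) (hpv : p ≠ v) (hq : G.Adj v q) (hqu : q ≠ u)
    (hw : Avoids G {u, v} k p q) (hk : k + 3 ≤ g) : p = α ↔ q = β :=
  ⟨fun he ↦ h.right_eq_of_avoids hH he hq hqu hw hk, fun he ↦
    h.swap.right_eq_of_avoids hH he hp hpv (by rw [Set.pair_comm]; exact hw.symm) hk⟩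

section Deck

variable [Fintype V] [DecidableEq V]

lemma Partner.false_of_avoids (h : Partner g G H) {p p' q : V} {k l : ℤ} (huv : u ≠ v)
    (hp : G.Adj u p) (hpv : p ≠ v) (hp' : G.Adj u p') (hpv' : p' ≠ v)
    (hN : ∀ w, G.Adj u w → w ≠ v → ¬ G.Adj v w → w = p ∨ w = p') (hq : G.Adj v q) (hqu : q ≠ u)
    (hw : Avoids G {u, v} k p q) (hk : k + 3 ≤ g)
    (hw' : Avoids G {u, v} l p' q) (hl : l + 3 ≤ g) : False := by
  obtain ⟨K, hK, α, β, γ, hS, h1, h2, h3, h4⟩ := h.exists_sw huv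
  have e1 := hS.eq_iff_of_avoids hK.girth' hp hpv hq hqu hw hk
  have e2 := hS.eq_iff_of_avoids hK.girth' hp' hpv' hq hqu hw' hl
  have e3 := hN α hS.adj_left hS.ne_left hS.not_adj_left
  have e4 := hN γ h2 h4 h3
  grind

lemma Partner.winds_eq (h : Partner g G H) (hg : 5 ≤ g) {p q : ℤ → V} (hp : Winds g G p)
    (hq : Winds g G q) (h0 : p 0 = q 0) (h1 : p 1 = q 1) (h2 : p 2 = q 2) : p = q := by
  have key (n : ℕ) : p n = q n ∧ p (n + 1) = q (n + 1) ∧ p (n + 2) = q (n + 2) := by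
    induction n with
    | zero => simp [h0, h1, h2]
    | succ n ih =>
      obtain ⟨e0, e1, e2⟩ := ih
      push_cast
      rw [add_assoc, add_assoc]
      refine ⟨e1, e2, ?_⟩
      norm_num
      by_contra hne
      have a1 : G.Adj (p (n + 2)) (p (n + 3)) := hp.adj' (by ring)
      have a2 : G.Adj (p (n + 2)) (q (n + 3)) := e2 ▸ hq.adj' (by ring)
      have a3 : G.Adj (p (n + 2)) (p (n + 1)) := (hp.adj' (by ring)).symm
      have a4 : G.Adj (p (n + 1)) (p n) := (hp.adj n).symm
      have n1 : p (n + 3) ≠ p (n + 1) := hp.ne' (by lia) (by lia)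
      have n2 : q (n + 3) ≠ p (n + 1) := e1 ▸ hq.ne' (by lia) (by lia)
      have w1 : Avoids G {p (n + 2), p (n + 1)} (g - 3) (p (n + 3)) (p n) := by
        rw [← hp.add n]
        refine hp.avoids (by lia) (by lia) fun l hl hl' ↦ ?_
        simp [hp.ne' (show (n : ℤ) + 2 < l by lia) (by lia),
          hp.ne' (show (n : ℤ) + 1 < l by lia) (by lia)]
      have w2 : Avoids G {p (n + 2), p (n + 1)} (g - 3) (q (n + 3)) (p n) := by
        rw [e0, e1, e2, ← hq.add n]
        refine hq.avoids (by lia) (by lia) fun l hl hl' ↦ ?_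
        simp [hq.ne' (show (n : ℤ) + 2 < l by lia) (by lia),
          hq.ne' (show (n : ℤ) + 1 < l by lia) (by lia)]
      refine h.false_of_avoids a3.ne a1 n1 a2 n2 (fun w hw hwv _ ↦ ?_) a4
        (hp.ne (by lia) (by lia)) w1 (by lia) w2 (by lia)
      have := h.reg.eq_or a1 a2 a3 hne n1 n2 hw
      tauto
  funext i
  rw [← hp.add_mul |i|, ← hq.add_mul |i|]
  obtain ⟨n, hn⟩ := Int.eq_ofNat_of_zero_le (show 0 ≤ i + |i| * g by
    have := neg_abs_le i
    have := le_mul_of_one_le_right (abs_nonneg i) (show (1 : ℤ) ≤ g by lia)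
    lia)
  rw [hn]
  exact (key n).1

section Kelly

open Classical in
/-- The sets of `g` vertices inducing a subgraph of minimum degree at least two. -/
noncomputable def fSet (g : ℕ) (G : SimpleGraph V) : Finset (Finset V) := {S | IsF g G S}

lemma card_le_of_induce_iso {S T : Finset V}
    (f : G.induce (S : Set V) ≃g H.induce (T : Set V)) :
    ((fSet g G).filter (· ⊆ S)).card ≤ ((fSet g H).filter (· ⊆ T)).card := by
  classical
  let ψ : Equiv.Perm V := Equiv.extendSubtype f.toEquiv
  have hψ (x : V) (hx : x ∈ (S : Set V)) : ψ x = f ⟨x, hx⟩ :=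
    Equiv.extendSubtype_apply_of_mem _ _ hx
  refine Finset.card_le_card_of_injOn (Finset.image ψ) (fun A hA ↦ ?_)
    (Finset.image_injective ψ.injective).injOn
  simp only [fSet, Finset.coe_filter, Finset.mem_filter, Finset.mem_univ, true_and,
    Set.mem_ofPred_eq] at hA ⊢
  obtain ⟨⟨h1, h2⟩, h3⟩ := hA
  have hadj (s t : V) (hs : s ∈ A) (ht : t ∈ A) (hst : G.Adj s t) : H.Adj (ψ s) (ψ t) := by
    rw [hψ s (h3 hs), hψ t (h3 ht)]
    exact f.map_adj_iff.2 hst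
  refine ⟨⟨(Finset.card_image_of_injective _ ψ.injective).trans h1, fun v hv ↦ ?_⟩, fun v hv ↦ ?_⟩
  · obtain ⟨v, hv', rfl⟩ := Finset.mem_image.1 hv
    obtain ⟨a, ha, b, hb, e1, e2, e3⟩ := h2 v hv'
    exact ⟨ψ a, Finset.mem_image_of_mem _ ha, ψ b, Finset.mem_image_of_mem _ hb,
      hadj _ _ hv' ha e1, hadj _ _ hv' hb e2, ψ.injective.ne e3⟩
  · obtain ⟨v, hv', rfl⟩ := Finset.mem_image.1 hv
    rw [hψ v (h3 hv')]
    exact (f ⟨v, h3 hv'⟩).2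

lemma sum_card_filter_subset (hn : g + 2 ≤ Fintype.card V) :
    ∑ T : {s : Finset V // s.card = Fintype.card V - 2}, ((fSet g G).filter (· ⊆ T.1)).card =
      (fSet g G).card * (Fintype.card V - g).choose 2 := by
  rw [← smul_eq_mul, ← Finset.sum_const]
  refine (Finset.sum_card_bipartiteAbove_eq_sum_card_bipartiteBelow
    (fun S (T : {s : Finset V // s.card = Fintype.card V - 2}) ↦ S ⊆ T.1)).symm.trans ?_
  refine Finset.sum_congr rfl fun S hS ↦ ?_
  have hS : S.card = g := by simp only [fSet, Finset.mem_filter] at hS; exact hS.2.1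
  rw [← hS, ← Finset.card_compl, ← Finset.card_powersetCard]
  refine Finset.card_bij (fun T _ ↦ T.1ᶜ) (fun T hT ↦ ?_) (fun T hT T' hT' he ↦ ?_) fun A hA ↦ ?_
  · simp only [Finset.bipartiteAbove, Finset.mem_filter, Finset.mem_univ, true_and] at hT
    rw [Finset.mem_powersetCard, Finset.compl_subset_compl, Finset.card_compl, T.2]
    exact ⟨hT, by lia⟩
  · exact Subtype.ext (compl_injective he)
  · rw [Finset.mem_powersetCard] at hA
    refine ⟨⟨Aᶜ, by rw [Finset.card_compl, hA.2]⟩, ?_, compl_compl A⟩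
    simp only [Finset.bipartiteAbove, Finset.mem_filter, Finset.mem_univ, true_and]
    exact Finset.subset_compl_comm.1 hA.1

/-- Kelly's lemma for the sets of `g` vertices of minimum degree at least two. -/
lemma card_fSet_eq (h : SameDeck G H (Fintype.card V - 2)) (hn : g + 2 ≤ Fintype.card V) :
    (fSet g G).card = (fSet g H).card := by
  obtain ⟨e, he⟩ := h
  have hpos : 0 < (Fintype.card V - g).choose 2 := Nat.choose_pos (by lia)
  refine Nat.eq_of_mul_eq_mul_right hpos ?_
  rw [← sum_card_filter_subset hn, ← sum_card_filter_subset hn]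
  refine Fintype.sum_equiv e _ _ fun T ↦ ?_
  obtain ⟨f⟩ := he T
  exact (card_le_of_induce_iso f).antisymm (card_le_of_induce_iso f.symm)

lemma exists_gained (h : SameDeck G H (Fintype.card V - 2)) (hn : g + 2 ≤ Fintype.card V)
    {S T : Finset V} (hST : S ≠ T) (hS : IsF g G S) (hT : IsF g G T) (hS' : ¬ IsF g H S)
    (hT' : ¬ IsF g H T) :
    ∃ S T, S ≠ T ∧ IsF g H S ∧ IsF g H T ∧ ¬ IsF g G S ∧ ¬ IsF g G T := by
  classical
  have h1 : 1 < (fSet g G \ fSet g H).card :=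
    Finset.one_lt_card.2 ⟨S, by simp [fSet, hS, hS'], T, by simp [fSet, hT, hT'], hST⟩
  rw [Finset.card_sdiff_comm (card_fSet_eq h hn), Finset.one_lt_card] at h1
  obtain ⟨S, hS, T, hT, hST⟩ := h1
  simp only [fSet, Finset.mem_sdiff, Finset.mem_filter, Finset.mem_univ, true_and] at hS hT
  exact ⟨S, T, hST, hS.1, hT.1, hS.2, hT.2⟩

end Kelly

lemma Partner.false_of_adj (h : Partner g G H) {p p' q : V} {k l : ℤ} (huv : G.Adj u v)
    (hp : G.Adj u p) (hpv : p ≠ v) (hp' : G.Adj u p') (hpv' : p' ≠ v) (hpp : p ≠ p')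
    (hq : G.Adj v q) (hqu : q ≠ u) (hw : Avoids G {u, v} k p q) (hk : k + 3 ≤ g)
    (hw' : Avoids G {u, v} l p' q) (hl : l + 3 ≤ g) : False :=
  h.false_of_avoids huv.ne hp hpv hp' hpv' (fun w hw hwv _ ↦ by
    have := h.reg.eq_or hp hp' huv hpp hpv hpv' hw
    tauto) hq hqu hw hk hw' hl

lemma Partner.false_of_common (h : Partner g G H) {p p' q z : V} {k l : ℤ} (huv : u ≠ v)
    (huz : G.Adj u z) (hvz : G.Adj v z)
    (hp : G.Adj u p) (hpv : p ≠ v) (hpz : p ≠ z) (hp' : G.Adj u p') (hpv' : p' ≠ v)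
    (hpz' : p' ≠ z) (hpp : p ≠ p')
    (hq : G.Adj v q) (hqu : q ≠ u) (hw : Avoids G {u, v} k p q) (hk : k + 3 ≤ g)
    (hw' : Avoids G {u, v} l p' q) (hl : l + 3 ≤ g) : False :=
  h.false_of_avoids huv hp hpv hp' hpv' (fun w hw hwv hn ↦ by
    rcases h.reg.eq_or hp hp' huz hpp hpz hpz' hw with h1 | h1 | rfl
    exacts [.inl h1, .inr h1, (hn hvz).elim]) hq hqu hw hk hw' hl

/-- If two cycles are lost and the gained cycles through `v` and `α` all pass through `z`, then
some gained cycle passes through `u` and `β`. -/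
lemma Partner.exists_winds_gained (h : Partner g G K) (hg : 5 ≤ g)
    (hn : g + 2 ≤ Fintype.card V) {α β z : V} (hs : Sw G K u v α β) {S T : Finset V}
    (hST : S ≠ T) (hS : IsF g G S) (hT : IsF g G T) (hS' : ¬ IsF g K S) (hT' : ¬ IsF g K T)
    (hz : ∀ q, Winds g K q → q 0 = v → q 1 = α → (∀ i, q i ≠ u) → q (-1) = z) :
    ∃ q, Winds g K q ∧ q 0 = u ∧ q 1 = β ∧ ∀ i, q i ≠ v := by
  have key (S : Finset V) (h1 : IsF g K S) (h2 : ¬ IsF g G S) :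
      (∃ q, Winds g K q ∧ q 0 = u ∧ q 1 = β ∧ ∀ i, q i ≠ v) ∨
      ∃ q, Winds g K q ∧ (∀ z, z ∈ S ↔ ∃ i, q i = z) ∧ q (-1) = z ∧ q 0 = v ∧ q 1 = α := by
    have hoff {q : ℤ → V} (hq : ∀ z, z ∈ S ↔ ∃ i, q i = z) {w : V} (hw : w ∉ S) (i : ℤ) :
        q i ≠ w := fun he ↦ hw ((hq w).2 ⟨i, he⟩)
    rcases hs.gained (by lia) h.girth h.girth' h1 h2 with ⟨e1, e2, e3⟩ | ⟨e1, e2, e3⟩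
    · obtain ⟨q, hq, hSq, q0, q1⟩ := h1.exists_oriented h.girth' (by lia) e1 e3 hs.symm.adj_left
      exact .inl ⟨q, hq, q0, q1, hoff hSq e2⟩
    · obtain ⟨q, hq, hSq, q0, q1⟩ := h1.exists_oriented h.girth' (by lia) e1 e3 hs.symm.adj_right
      exact .inr ⟨q, hq, hSq, hz q hq q0 q1 (hoff hSq e2), q0, q1⟩
  obtain ⟨S, T, hST, h1, h2, h3, h4⟩ := exists_gained h.deck hn hST hS hT hS' hT'
  obtain hq | ⟨q, hq, hSq, q0, q1, q2⟩ := key S h1 h3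
  · exact hq
  obtain hr | ⟨r, hr, hTr, r0, r1, r2⟩ := key T h2 h4
  · exact hr
  have := h.symm.winds_eq hg (hq.shift (-1)) (hr.shift (-1)) (by simp [q0, r0])
    (by simp [q1, r1]) (by simp [q2, r2])
  have hqr : q = r := funext fun i ↦ by simpa using congrFun this (i + 1)
  exact (hST (Finset.ext fun w ↦ by rw [hSq, hTr, hqr])).elim

end Deck

/-- The windings of four `g`-cycles, the first two through `xy`, the third through `x` and not
`y`, the fourth through `y` and not `x`, with names for the vertices near `xy`. -/
structure Config (g : ℕ) (G : SimpleGraph V) (p t r s : ℤ → V)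
    (x y a b c d a₁ d₁ a₂ d₂ e : V) : Prop where
  five_le : 5 ≤ g
  girth : (g : ℕ∞) ≤ G.egirth
  reg : Reg G
  hp : Winds g G p
  ht : Winds g G t
  hr : Winds g G r
  hs : Winds g G s
  p_neg_two : p (-2) = a₁
  p_neg_one : p (-1) = a
  p_zero : p 0 = x
  p_one : p 1 = y
  p_two : p 2 = d
  p_three : p 3 = d₁
  t_neg_one : t (-1) = b
  t_zero : t 0 = x
  t_one : t 1 = y
  t_two : t 2 = c
  r_neg_one : r (-1) = b
  r_zero : r 0 = x
  r_one : r 1 = a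
  r_two : r 2 = a₂
  r_three : r 3 = e
  s_neg_one : s (-1) = c
  s_zero : s 0 = y
  s_one : s 1 = d
  s_two : s 2 = d₂
  r_ne (i : ℤ) : r i ≠ y
  s_ne (i : ℤ) : s i ≠ x
  a_ne_b : a ≠ b
  c_ne_d : c ≠ d
  a₂_ne_a₁ : a₂ ≠ a₁
  d₂_ne_d₁ : d₂ ≠ d₁

namespace Config

variable {p t r s : ℤ → V} {x y a b c d a₁ d₁ a₂ d₂ e : V}

lemma y_ne_a (h : Config g G p t r s x y a b c d a₁ d₁ a₂ d₂ e) : y ≠ a := by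
  rw [← h.r_one]; exact (h.r_ne _).symm

lemma y_ne_b (h : Config g G p t r s x y a b c d a₁ d₁ a₂ d₂ e) : y ≠ b := by
  rw [← h.r_neg_one]; exact (h.r_ne _).symm

lemma x_ne_c (h : Config g G p t r s x y a b c d a₁ d₁ a₂ d₂ e) : x ≠ c := by
  rw [← h.s_neg_one]; exact (h.s_ne _).symm

lemma x_ne_d (h : Config g G p t r s x y a b c d a₁ d₁ a₂ d₂ e) : x ≠ d := by
  rw [← h.s_one]; exact (h.s_ne _).symm

lemma y_ne_a₂ (h : Config g G p t r s x y a b c d a₁ d₁ a₂ d₂ e) : y ≠ a₂ := by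
  rw [← h.r_two]; exact (h.r_ne _).symm

lemma x_ne_a₂ (h : Config g G p t r s x y a b c d a₁ d₁ a₂ d₂ e) : x ≠ a₂ := by
  have := h.five_le
  exact h.r_two ▸ (h.hr.ne_of h.r_zero).symm

lemma xy (h : Config g G p t r s x y a b c d a₁ d₁ a₂ d₂ e) : G.Adj x y :=
  h.hp.adj_of h.p_zero h.p_one

lemma xa (h : Config g G p t r s x y a b c d a₁ d₁ a₂ d₂ e) : G.Adj x a :=
  h.hr.adj_of h.r_zero h.r_one

lemma xb (h : Config g G p t r s x y a b c d a₁ d₁ a₂ d₂ e) : G.Adj x b :=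
  (h.hr.adj_of h.r_neg_one h.r_zero).symm

lemma yc (h : Config g G p t r s x y a b c d a₁ d₁ a₂ d₂ e) : G.Adj y c :=
  h.ht.adj_of h.t_one h.t_two

lemma yd (h : Config g G p t r s x y a b c d a₁ d₁ a₂ d₂ e) : G.Adj y d :=
  h.hp.adj_of h.p_one h.p_two

lemma aa₁ (h : Config g G p t r s x y a b c d a₁ d₁ a₂ d₂ e) : G.Adj a a₁ :=
  (h.hp.adj_of h.p_neg_two h.p_neg_one).symm

lemma aa₂ (h : Config g G p t r s x y a b c d a₁ d₁ a₂ d₂ e) : G.Adj a a₂ :=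
  h.hr.adj_of h.r_one h.r_two

lemma a₂e (h : Config g G p t r s x y a b c d a₁ d₁ a₂ d₂ e) : G.Adj a₂ e :=
  h.hr.adj_of h.r_two h.r_three

lemma dd₁ (h : Config g G p t r s x y a b c d a₁ d₁ a₂ d₂ e) : G.Adj d d₁ :=
  h.hp.adj_of h.p_two h.p_three

lemma dd₂ (h : Config g G p t r s x y a b c d a₁ d₁ a₂ d₂ e) : G.Adj d d₂ :=
  h.hs.adj_of h.s_one h.s_two

lemma eq_of_adj_x (h : Config g G p t r s x y a b c d a₁ d₁ a₂ d₂ e) {w : V} (hw : G.Adj x w) :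
    w = y ∨ w = a ∨ w = b :=
  h.reg.eq_or h.xy h.xa h.xb h.y_ne_a h.y_ne_b h.a_ne_b hw

lemma eq_of_adj_y (h : Config g G p t r s x y a b c d a₁ d₁ a₂ d₂ e) {w : V} (hw : G.Adj y w) :
    w = x ∨ w = c ∨ w = d :=
  h.reg.eq_or h.xy.symm h.yc h.yd h.x_ne_c h.x_ne_d h.c_ne_d hw

lemma x_ne_a₁ (h : Config g G p t r s x y a b c d a₁ d₁ a₂ d₂ e) : x ≠ a₁ := by
  have := h.five_le
  exact h.p_neg_two ▸ (h.hp.ne_of h.p_zero).symm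

lemma y_ne_d₂ (h : Config g G p t r s x y a b c d a₁ d₁ a₂ d₂ e) : y ≠ d₂ := by
  have := h.five_le
  exact h.s_two ▸ (h.hs.ne_of h.s_zero).symm

lemma y_ne_d₁ (h : Config g G p t r s x y a b c d a₁ d₁ a₂ d₂ e) : y ≠ d₁ := by
  have := h.five_le
  exact h.p_three ▸ (h.hp.ne_of h.p_one).symm

lemma a_ne_e (h : Config g G p t r s x y a b c d a₁ d₁ a₂ d₂ e) : a ≠ e := by
  have := h.five_le
  exact h.r_three ▸ (h.hr.ne_of h.r_one).symm

lemma eq_of_adj_a (h : Config g G p t r s x y a b c d a₁ d₁ a₂ d₂ e) {w : V} (hw : G.Adj a w) :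
    w = x ∨ w = a₁ ∨ w = a₂ :=
  h.reg.eq_or h.xa.symm h.aa₁ h.aa₂ h.x_ne_a₁ h.x_ne_a₂ h.a₂_ne_a₁.symm hw

lemma eq_of_adj_d (h : Config g G p t r s x y a b c d a₁ d₁ a₂ d₂ e) {w : V} (hw : G.Adj d w) :
    w = y ∨ w = d₁ ∨ w = d₂ :=
  h.reg.eq_or h.yd.symm h.dd₁ h.dd₂ h.y_ne_d₁ h.y_ne_d₂ h.d₂_ne_d₁.symm hw

lemma p_ne_a₂ (h : Config g G p t r s x y a b c d a₁ d₁ a₂ d₂ e) (i : ℤ) : p i ≠ a₂ := by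
  have := h.five_le
  refine h.hp.forall_ne h.girth (by lia) h.p_neg_one h.aa₂ ?_ ?_ i
  · exact h.p_zero ▸ h.x_ne_a₂
  · exact h.p_neg_two ▸ h.a₂_ne_a₁.symm

lemma t_ne_a (h : Config g G p t r s x y a b c d a₁ d₁ a₂ d₂ e) (i : ℤ) : t i ≠ a := by
  have := h.five_le
  refine h.ht.forall_ne h.girth (by lia) h.t_zero h.xa ?_ ?_ i
  · exact h.t_one ▸ h.y_ne_a
  · exact h.t_neg_one ▸ h.a_ne_b.symm

lemma a_ne_d (h : Config g G p t r s x y a b c d a₁ d₁ a₂ d₂ e) : a ≠ d := by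
  have := h.five_le
  exact h.p_two ▸ (h.hp.ne_of h.p_neg_one).symm

lemma b_ne_c (h : Config g G p t r s x y a b c d a₁ d₁ a₂ d₂ e) : b ≠ c := by
  have := h.five_le
  exact h.t_two ▸ (h.ht.ne_of h.t_neg_one).symm

lemma b_ne_a₂ (h : Config g G p t r s x y a b c d a₁ d₁ a₂ d₂ e) : b ≠ a₂ := by
  have := h.five_le
  exact h.r_two ▸ (h.hr.ne_of h.r_neg_one).symm

lemma y_ne_a₁ (h : Config g G p t r s x y a b c d a₁ d₁ a₂ d₂ e) : y ≠ a₁ := by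
  have := h.five_le
  exact h.p_neg_two ▸ (h.hp.ne_of h.p_one).symm

lemma c_ne_a (h : Config g G p t r s x y a b c d a₁ d₁ a₂ d₂ e) : c ≠ a :=
  h.t_two ▸ h.t_ne_a _

lemma d_ne_a₂ (h : Config g G p t r s x y a b c d a₁ d₁ a₂ d₂ e) : d ≠ a₂ :=
  h.p_two ▸ h.p_ne_a₂ _

lemma s_ne_a (h : Config g G p t r s x y a b c d a₁ d₁ a₂ d₂ e) (i : ℤ) : s i ≠ a := by
  have hg := h.five_le
  intro hi
  obtain ⟨j, j1, j2, j3⟩ := h.hs.exists_index_ne (k := i) (i := 0) (by lia)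
    (by rw [hi, h.s_zero]; exact h.y_ne_a.symm)
  rw [hi] at j3
  have w1 : Avoids G {x} j y a := h.hs.avoids_of h.s_zero j3 fun l _ _ ↦ h.s_ne l
  have w2 : Avoids G {x} (g - j) a y := h.hs.avoids_of j3 (h.hs.add_eq h.s_zero)
    fun l _ _ ↦ h.s_ne l
  have := le_of_avoids h.girth (by simp) w1 h.xy h.xa h.y_ne_a
  have := le_of_avoids h.girth (by simp) w2 h.xa h.xy h.y_ne_a.symm
  lia

variable [Fintype V] [DecidableEq V]

lemma s_ne_a₂ (h : Config g G p t r s x y a b c d a₁ d₁ a₂ d₂ e) (hP : Partner g G H) (i : ℤ) :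
    s i ≠ a₂ := by
  have hg := h.five_le
  intro hi
  obtain ⟨j, j1, j2, j3⟩ := h.hs.exists_index_ne (k := i) (i := 0) (by lia)
    (by rw [hi, h.s_zero]; exact h.y_ne_a₂.symm)
  rw [hi] at j3
  have hA (l : ℤ) : s l ∉ ({a, x} : Set V) := not_or.2 ⟨h.s_ne_a l, h.s_ne l⟩
  have w1 : Avoids G {a, x} (g - 3) a₁ y :=
    (h.hp.avoids_of h.p_one (h.hp.add_eq h.p_neg_two) fun l _ _ ↦
      not_or.2 ⟨h.hp.ne_of h.p_neg_one, h.hp.ne_of h.p_zero⟩).symm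
  have w2 : Avoids G {a, x} (g - 3) a₂ y := by
    by_cases hj : j + 3 ≤ g
    · exact (h.hs.avoids_of h.s_zero j3 fun l _ _ ↦ hA l).symm
    · exact h.hs.avoids_of j3 (h.hs.add_eq h.s_zero) fun l _ _ ↦ hA l
  exact hP.false_of_adj h.xa.symm h.aa₁ h.x_ne_a₁.symm h.aa₂ h.x_ne_a₂.symm h.a₂_ne_a₁.symm h.xy
    h.y_ne_a w1 (by lia) w2 (by lia)

lemma t_ne_a₂ (h : Config g G p t r s x y a b c d a₁ d₁ a₂ d₂ e) (hP : Partner g G H) (i : ℤ) :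
    t i ≠ a₂ := by
  have hg := h.five_le
  intro hi
  obtain ⟨j, j1, j2, j3⟩ := h.ht.exists_index_ne (k := i) (i := 0) (by lia)
    (by rw [hi, h.t_zero]; exact h.x_ne_a₂.symm)
  rw [hi] at j3
  have j4 : j ≠ -1 + g := by
    rintro rfl
    exact h.b_ne_a₂ ((h.ht.add_eq h.t_neg_one).symm.trans j3)
  have w1 : Avoids G {a, x} (g - 3) a₁ y :=
    (h.hp.avoids_of h.p_one (h.hp.add_eq h.p_neg_two) fun l _ _ ↦
      not_or.2 ⟨h.hp.ne_of h.p_neg_one, h.hp.ne_of h.p_zero⟩).symm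
  have w2 : Avoids G {a, x} (g - 3) a₂ y :=
    (h.ht.avoids_of h.t_one j3 fun l _ _ ↦ not_or.2 ⟨h.t_ne_a l, h.ht.ne_of h.t_zero⟩).symm
  exact hP.false_of_adj h.xa.symm h.aa₁ h.x_ne_a₁.symm h.aa₂ h.x_ne_a₂.symm h.a₂_ne_a₁.symm h.xy
    h.y_ne_a w1 (by lia) w2 (by lia)

lemma exists_sw_xy (h : Config g G p t r s x y a b c d a₁ d₁ a₂ d₂ e) (hP : Partner g G H) :
    ∃ K, Partner g G K ∧ Sw G K x y b c := by
  have hg := h.five_le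
  obtain ⟨K, hK, α, β, -, hS, -⟩ := hP.exists_sw h.xy.ne
  have e1 : a = α ↔ d = β := hS.eq_iff_of_avoids hK.girth' (k := g - 3) h.xa h.y_ne_a.symm h.yd
    h.x_ne_d.symm (h.hp.avoids_of h.p_two (h.hp.add_eq h.p_neg_one) fun l _ _ ↦
      not_or.2 ⟨h.hp.ne_of h.p_zero, h.hp.ne_of h.p_one⟩).symm (by lia)
  have e2 := h.eq_of_adj_x hS.adj_left
  have e3 := h.eq_of_adj_y hS.adj_right
  have e4 := hS.ne_left
  have e5 := hS.ne_right
  by_cases hα : a = α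
  · obtain rfl := e1.1 hα
    subst hα
    refine ⟨_, hK.of_iso (Iso.comap (Equiv.swap x y) K), hS.flip (fun w hw ↦ ⟨fun h1 ↦ ?_, ?_⟩)
      (fun w hw ↦ ⟨fun h1 ↦ ?_, ?_⟩) h.a_ne_b h.c_ne_d.symm h.y_ne_b.symm h.x_ne_c.symm h.b_ne_c⟩
    · exact (h.eq_of_adj_x h1).resolve_left hw
    · rintro (rfl | rfl)
      exacts [h.xa, h.xb]
    · exact ((h.eq_of_adj_y h1).resolve_left hw).symm
    · rintro (rfl | rfl)
      exacts [h.yd, h.yc]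
  · obtain rfl : α = b := by tauto
    obtain rfl : β = c := by tauto
    exact ⟨K, hK, hS⟩

lemma exists_winds_xy (h : Config g G p t r s x y a b c d a₁ d₁ a₂ d₂ e) (hK : Partner g G K)
    (hn : g + 2 ≤ Fintype.card V) (hS : Sw G K x y b c) :
    ∃ q, Winds g K q ∧ q 0 = x ∧ q 1 = c ∧ ∀ i, q i ≠ y := by
  have hg := h.five_le
  have hr (w : V) : w ∈ range g r ↔ ∃ i, r i = w := h.hr.mem_range (by lia)
  have hs (w : V) : w ∈ range g s ↔ ∃ i, s i = w := h.hs.mem_range (by lia)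
  have hxr : x ∈ range g r := (hr x).2 ⟨_, h.r_zero⟩
  have hxs : x ∉ range g s := by simpa [hs] using h.s_ne
  refine hK.exists_winds_gained hg hn hS (ne_of_mem_of_not_mem' hxr hxs)
    (h.hr.isF_range (by lia)) (h.hs.isF_range (by lia))
    (hS.not_isF (by lia) hK.girth hK.girth' (h.hr.isF_range (by lia)) hxr
      ((hr b).2 ⟨_, h.r_neg_one⟩) (by simpa [hr] using h.r_ne))
    (hS.swap.not_isF (by lia) hK.girth hK.girth' (h.hs.isF_range (by lia))
      ((hs y).2 ⟨_, h.s_zero⟩) ((hs c).2 ⟨_, h.s_neg_one⟩) hxs) (z := d) ?_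
  intro q hq q0 q1 hqx
  have h1 : K.Adj y (q (-1)) := (hq.adj_of rfl q0).symm
  rcases (hS.right _ (hqx _)).1 h1 with ⟨h2, h3⟩ | h2
  · have := hqx (-1)
    have := h.eq_of_adj_y h2
    tauto
  · exact absurd h2 (hq.ne_of q1)

lemma exists_avoids (h : Config g G p t r s x y a b c d a₁ d₁ a₂ d₂ e) (hP : Partner g G H)
    (hn : g + 2 ≤ Fintype.card V) :
    ∃ f, G.Adj a₂ f ∧ f ≠ a ∧ f ≠ e ∧ Avoids G {x, y, a, a₂, d} (g - 4) c f := by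
  have hg := h.five_le
  obtain ⟨K, hK, hS⟩ := h.exists_sw_xy hP
  obtain ⟨q, hq, q0, q1, hqy⟩ := h.exists_winds_xy hK hn hS
  have hoff {w z : V} (hwx : w ≠ x) (hwy : w ≠ y) (hzx : z ≠ x) (hzy : z ≠ y) :
      K.Adj w z ↔ G.Adj w z := hS.off w z hwx hwy hzx hzy
  have qa : q (-1) = a := by
    have h1 : K.Adj x (q (-1)) := (hq.adj_of rfl q0).symm
    rcases (hS.left _ (hqy _)).1 h1 with ⟨h2, h3⟩ | h2
    · have := hqy (-1)
      have := h.eq_of_adj_x h2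
      tauto
    · exact absurd h2 (hq.ne_of q1)
  have hKxa : K.Adj x a := (hq.adj_of qa q0).symm
  have qa₂ : q (-2) = a₂ := by
    have h1 : K.Adj a (q (-2)) := (hq.adj_of rfl qa).symm
    rw [hoff hKxa.ne' h.y_ne_a.symm (hq.ne_of q0) (hqy _)] at h1
    rcases h.eq_of_adj_a h1 with h2 | h2 | h2
    · exact absurd h2 (hq.ne_of q0)
    · exfalso
      have w1 : Avoids G {x, y, a} (g - 4) d a₁ :=
        h.hp.avoids_of h.p_two (h.hp.add_eq h.p_neg_two) fun l _ _ ↦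
          not_or.2 ⟨h.hp.ne_of h.p_zero, not_or.2 ⟨h.hp.ne_of h.p_one, h.hp.ne_of h.p_neg_one⟩⟩
      have w2 : Avoids K {x, a} (g - 3) y a₁ :=
        (((hS.transfer w1 (by simp) (by simp)).mono (B := {x, a}) (by grind) le_rfl).cons
          ((hS.right d h.x_ne_d.symm).2 (.inl ⟨h.yd, h.c_ne_d.symm⟩))
          (not_or.2 ⟨h.xy.ne', h.y_ne_a⟩)).mono subset_rfl (by lia)
      have w3 : Avoids K {x, a} (g - 3) c a₁ := hq.avoids_of q1 (hq.add_eq h2) fun l _ _ ↦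
        not_or.2 ⟨hq.ne_of q0, hq.ne_of qa⟩
      exact hK.symm.false_of_adj hKxa (hS.uv.2 h.xy) h.y_ne_a hS.symm.adj_left h.c_ne_a h.yc.ne
        ((hoff hKxa.ne' h.y_ne_a.symm h.x_ne_a₁.symm h.y_ne_a₁.symm).2 h.aa₁) h.x_ne_a₁.symm
        w2 (by lia) w3 (by lia)
    · exact h2
  have hf : G.Adj a₂ (q (-3)) := (hoff h.x_ne_a₂.symm h.y_ne_a₂.symm (hq.ne_of q0) (hqy _)).1
    (hq.adj_of rfl qa₂).symm
  have hqf : q (-3 + g) = q (-3) := hq.add _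
  have hqd (j : ℤ) (j1 : 1 ≤ j) (j2 : j ≤ g - 2) : q j ≠ d := by
    intro hj
    have w : Avoids K {x, y} (j - 1) c d := hq.avoids_of q1 hj fun l _ _ ↦
      not_or.2 ⟨hq.ne_of q0, hqy l⟩
    have := le_of_avoids h.girth (u := y) (by simp) (hS.symm.transfer w (by simp) (by simp))
      h.yc h.yd h.c_ne_d
    lia
  have hw : Avoids G {x, y, a, a₂, d} (g - 4) c (q (-3)) := by
    refine hS.symm.transfer (hq.avoids_of q1 hqf fun l _ _ ↦ ?_) (by simp) (by simp)
    exact not_or.2 ⟨hq.ne_of q0, not_or.2 ⟨hqy l, not_or.2 ⟨hq.ne_of qa,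
      not_or.2 ⟨hq.ne_of qa₂, hqd l (by lia) (by lia)⟩⟩⟩⟩
  refine ⟨q (-3), hf, hq.ne_of qa, fun he ↦ ?_, hw⟩
  rw [he] at hw
  have w1 : Avoids G {x, a₂} (g - 3) b e := (h.hr.avoids_of h.r_three (h.hr.add_eq h.r_neg_one)
    fun l _ _ ↦ not_or.2 ⟨h.hr.ne_of h.r_zero, h.hr.ne_of h.r_two⟩).symm
  have w2 : Avoids G {x, a₂} (g - 3) y e :=
    ((hw.mono (B := {x, a₂}) (by grind) le_rfl).cons h.yc
      (not_or.2 ⟨h.xy.ne', h.y_ne_a₂⟩)).mono subset_rfl (by lia)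
  exact hP.false_of_common h.x_ne_a₂ h.xa h.aa₂.symm h.xb h.b_ne_a₂ h.a_ne_b.symm h.xy h.y_ne_a₂
    h.y_ne_a h.y_ne_b.symm h.a₂e (h.r_three ▸ h.hr.ne_of h.r_zero) w1 (by lia) w2 (by lia)

lemma exists_sw_ya₂ (h : Config g G p t r s x y a b c d a₁ d₁ a₂ d₂ e) (hP : Partner g G H)
    {f : V} (hf : G.Adj a₂ f) (hfa : f ≠ a) (hfe : f ≠ e) :
    ∃ K, Partner g G K ∧ Sw G K y a₂ c f := by
  have hg := h.five_le
  obtain ⟨K, hK, α, β, -, hS, -⟩ := hP.exists_sw h.y_ne_a₂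
  have e1 : x = α ↔ a = β := hS.eq_iff_of_avoids hK.girth' (k := g - 3) h.xy.symm h.x_ne_a₂
    h.aa₂.symm h.y_ne_a.symm (h.hp.avoids_of h.p_neg_one h.p_zero fun l _ _ ↦
      not_or.2 ⟨h.hp.ne_of h.p_one, h.p_ne_a₂ l⟩).symm (by lia)
  have e2 : d = α ↔ a = β := hS.eq_iff_of_avoids hK.girth' (k := g - 3) h.yd h.d_ne_a₂
    h.aa₂.symm h.y_ne_a.symm (h.hp.avoids_of h.p_two (h.hp.add_eq h.p_neg_one) fun l _ _ ↦
      not_or.2 ⟨h.hp.ne_of h.p_one, h.p_ne_a₂ l⟩) (by lia)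
  have e3 : x = α ↔ e = β := hS.eq_iff_of_avoids hK.girth' (k := g - 3) h.xy.symm h.x_ne_a₂
    h.a₂e (h.r_three ▸ h.r_ne _) (h.hr.avoids_of h.r_three (h.hr.add_eq h.r_zero) fun l _ _ ↦
      not_or.2 ⟨h.r_ne l, h.hr.ne_of h.r_two⟩).symm (by lia)
  have e4 := h.eq_of_adj_y hS.adj_left
  have e5 := h.reg.eq_or h.aa₂.symm h.a₂e hf h.a_ne_e hfa.symm hfe.symm hS.adj_right
  have e6 := h.a_ne_e
  have e7 := h.x_ne_d
  obtain rfl : α = c := by grind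
  obtain rfl : β = f := by grind
  exact ⟨K, hK, hS⟩

lemma exists_winds_ya₂ (h : Config g G p t r s x y a b c d a₁ d₁ a₂ d₂ e) (hK : Partner g G K)
    (hn : g + 2 ≤ Fintype.card V) {f : V} (hf : G.Adj a₂ f) (hfa : f ≠ a) (hfe : f ≠ e)
    (hS : Sw G K y a₂ c f) : ∃ q, Winds g K q ∧ q 0 = y ∧ q 1 = f ∧ ∀ i, q i ≠ a₂ := by
  have hg := h.five_le
  have ht (w : V) : w ∈ range g t ↔ ∃ i, t i = w := h.ht.mem_range (by lia)
  have hs (w : V) : w ∈ range g s ↔ ∃ i, s i = w := h.hs.mem_range (by lia)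
  have hxt : x ∈ range g t := (ht x).2 ⟨_, h.t_zero⟩
  have hxs : x ∉ range g s := by simpa [hs] using h.s_ne
  refine hK.exists_winds_gained hg hn hS (ne_of_mem_of_not_mem' hxt hxs)
    (h.ht.isF_range (by lia)) (h.hs.isF_range (by lia))
    (hS.not_isF (by lia) hK.girth hK.girth' (h.ht.isF_range (by lia)) ((ht y).2 ⟨_, h.t_one⟩)
      ((ht c).2 ⟨_, h.t_two⟩) (by simpa [ht] using h.t_ne_a₂ hK))
    (hS.not_isF (by lia) hK.girth hK.girth' (h.hs.isF_range (by lia)) ((hs y).2 ⟨_, h.s_zero⟩)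
      ((hs c).2 ⟨_, h.s_neg_one⟩) (by simpa [hs] using h.s_ne_a₂ hK)) (z := e) ?_
  intro q hq q0 q1 hqy
  have h1 : K.Adj a₂ (q (-1)) := (hq.adj_of rfl q0).symm
  rcases (hS.right _ (hqy _)).1 h1 with ⟨h2, h3⟩ | h2
  · rcases h.reg.eq_or h.aa₂.symm h.a₂e hf h.a_ne_e hfa.symm hfe.symm h2 with qa | qe | h4
    · exfalso
      have h5 : G.Adj a (q (-2)) := (hS.off a (q (-2)) h.y_ne_a.symm h.aa₂.ne (hqy _)
        (hq.ne_of q0)).1 (hq.adj_of rfl qa).symm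
      have hw : Avoids G {y, a, a₂} (g - 3) c (q (-2)) :=
        hS.symm.transfer (hq.avoids_of q1 (hq.add (-2)) fun l _ _ ↦
          not_or.2 ⟨hqy l, not_or.2 ⟨hq.ne_of qa, hq.ne_of q0⟩⟩) (by simp) (by simp)
      rcases h.eq_of_adj_a h5 with h6 | h6 | h6
      · rw [h6] at hw
        have := le_of_avoids h.girth (by simp) hw h.yc h.xy.symm h.x_ne_c.symm
        lia
      · rw [h6] at hw
        have w1 : Avoids G {y, a} (g - 3) d a₁ :=
          h.hp.avoids_of h.p_two (h.hp.add_eq h.p_neg_two) fun l _ _ ↦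
            not_or.2 ⟨h.hp.ne_of h.p_one, h.hp.ne_of h.p_neg_one⟩
        exact hK.false_of_common h.y_ne_a h.xy.symm h.xa.symm h.yd h.a_ne_d.symm h.x_ne_d.symm
          h.yc h.c_ne_a h.x_ne_c.symm h.c_ne_d.symm h.aa₁ h.y_ne_a₁.symm w1 (by lia)
          (hw.mono (by grind) le_rfl) (by lia)
      · exact absurd h6 (hq.ne_of q0)
    · exact qe
    · exact (h3 h4).elim
  · exact absurd h2 (hq.ne_of q1)

lemma avoids_d₂ (h : Config g G p t r s x y a b c d a₁ d₁ a₂ d₂ e) (hP : Partner g G H)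
    (hn : g + 2 ≤ Fintype.card V) {f : V} (hf : G.Adj a₂ f) (hfa : f ≠ a) (hfe : f ≠ e)
    (hfx : f ≠ x) (hfd : f ≠ d) : Avoids G {y, a₂, d} (g - 3) f d₂ := by
  have hg := h.five_le
  obtain ⟨K, hK, hS⟩ := h.exists_sw_ya₂ hP hf hfa hfe
  obtain ⟨q, hq, q0, q1, hqa⟩ := h.exists_winds_ya₂ hK hn hf hfa hfe hS
  have hoff {w z : V} (hwx : w ≠ y) (hwy : w ≠ a₂) (hzx : z ≠ y) (hzy : z ≠ a₂) :
      K.Adj w z ↔ G.Adj w z := hS.off w z hwx hwy hzx hzy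
  have h1 : K.Adj y (q (-1)) := (hq.adj_of rfl q0).symm
  have qd : q (-1) = d := by
    rcases (hS.left _ (hqa _)).1 h1 with ⟨h2, h3⟩ | h2
    · rcases h.eq_of_adj_y h2 with h4 | h4 | h4
      · exfalso
        have h5 : G.Adj x (q (-2)) := (hoff h.xy.ne h.x_ne_a₂ (hq.ne_of q0) (hqa _)).1
          (hq.adj_of rfl h4).symm
        have hw : Avoids G {y, a₂, x} (g - 3) f (q (-2)) :=
          hS.symm.transfer (hq.avoids_of q1 (hq.add (-2)) fun l _ _ ↦
            not_or.2 ⟨hq.ne_of q0, not_or.2 ⟨hqa l, hq.ne_of h4⟩⟩) (by simp) (by simp)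
        rcases h.eq_of_adj_x h5 with h6 | h6 | h6
        · exact absurd h6 (hq.ne_of q0)
        · rw [h6] at hw
          have := le_of_avoids h.girth (by simp) hw hf h.aa₂.symm hfa
          lia
        · rw [h6] at hw
          have w1 : Avoids G {a₂, x} (g - 3) e b :=
            h.hr.avoids_of h.r_three (h.hr.add_eq h.r_neg_one) fun l _ _ ↦
              not_or.2 ⟨h.hr.ne_of h.r_two, h.hr.ne_of h.r_zero⟩
          exact hK.false_of_common h.x_ne_a₂.symm h.aa₂.symm h.xa h.a₂e
            (h.r_three ▸ h.hr.ne_of h.r_zero) h.a_ne_e.symm hf hfx hfa hfe.symm h.xb h.b_ne_a₂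
            w1 (by lia) (hw.mono (by grind) le_rfl) (by lia)
      · exact (h3 h4).elim
      · exact h4
    · exact absurd h2 (hq.ne_of q1)
  have h5 : G.Adj d (q (-2)) := (hoff h.yd.ne' h.d_ne_a₂ (hq.ne_of q0) (hqa _)).1
    (hq.adj_of rfl qd).symm
  have hw : Avoids K {y, a₂, d} (g - 3) f (q (-2)) :=
    hq.avoids_of q1 (hq.add (-2)) fun l _ _ ↦
      not_or.2 ⟨hq.ne_of q0, not_or.2 ⟨hqa l, hq.ne_of qd⟩⟩
  rcases h.eq_of_adj_d h5 with h6 | h6 | h6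
  · exact absurd h6 (hq.ne_of q0)
  · exfalso
    rw [h6] at hw
    have w1 : Avoids G {y, a₂, d} (g - 3) x d₁ :=
      (h.hp.avoids_of h.p_three (h.hp.add_eq h.p_zero) fun l _ _ ↦
        not_or.2 ⟨h.hp.ne_of h.p_one, not_or.2 ⟨h.p_ne_a₂ l, h.hp.ne_of h.p_two⟩⟩).symm
    exact hK.symm.false_of_adj (qd ▸ h1) ((hS.left x h.x_ne_a₂).2 (.inl ⟨h.xy.symm, h.x_ne_c⟩))
      h.x_ne_d hS.symm.adj_left hfd hfx.symm
      ((hoff h.yd.ne' h.d_ne_a₂ h.y_ne_d₁.symm (h.p_three ▸ h.p_ne_a₂ _)).2 h.dd₁) h.y_ne_d₁.symm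
      ((hS.transfer w1 (by simp) (by simp)).mono (by grind) le_rfl) (by lia)
      (hw.mono (by grind) le_rfl) (by lia)
  · rw [h6] at hw
    exact hS.symm.transfer hw (by simp) (by simp)

theorem false (h : Config g G p t r s x y a b c d a₁ d₁ a₂ d₂ e) (hP : Partner g G H)
    (hn : g + 2 ≤ Fintype.card V) : False := by
  have hg := h.five_le
  obtain ⟨f, hf, hfa, hfe, hcf⟩ := h.exists_avoids hP hn
  have hfA : f ∉ ({x, y, a, a₂, d} : Set V) := by
    obtain ⟨w, -, hw⟩ := hcf
    exact hw f w.end_mem_support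
  simp only [Set.mem_insert_iff, Set.mem_singleton_iff, not_or] at hfA
  obtain ⟨hfx, hfy, -, -, hfd⟩ := hfA
  have hfd₂ := h.avoids_d₂ hP hn hf hfa hfe hfx hfd
  obtain ⟨K, hK, α, β, -, hS, -⟩ := hP.exists_sw h.d_ne_a₂.symm
  have hd₁ : d₁ ≠ a₂ := h.p_three ▸ h.p_ne_a₂ _
  have hd₂ : d₂ ≠ a₂ := h.s_two ▸ h.s_ne_a₂ hP _
  have e1 : a = α ↔ y = β := hS.eq_iff_of_avoids hK.girth' (k := g - 3) h.aa₂.symm h.a_ne_d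
    h.yd.symm h.y_ne_a₂ (h.hp.avoids_of h.p_neg_one h.p_one fun l _ _ ↦
      not_or.2 ⟨h.p_ne_a₂ l, h.hp.ne_of h.p_two⟩) (by lia)
  have e2 : a = α ↔ d₁ = β := hS.eq_iff_of_avoids hK.girth' (k := g - 3) h.aa₂.symm h.a_ne_d
    h.dd₁ hd₁ (h.hp.avoids_of h.p_three (h.hp.add_eq h.p_neg_one) fun l _ _ ↦
      not_or.2 ⟨h.p_ne_a₂ l, h.hp.ne_of h.p_two⟩).symm (by lia)
  have e3 : f = α ↔ y = β := hS.eq_iff_of_avoids hK.girth' (k := g - 3) hf hfd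
    h.yd.symm h.y_ne_a₂ (((hcf.mono (B := {a₂, d}) (by grind) le_rfl).cons h.yc
      (not_or.2 ⟨h.y_ne_a₂, h.yd.ne⟩)).symm.mono subset_rfl (by lia)) (by lia)
  have e4 : f = α ↔ d₂ = β := hS.eq_iff_of_avoids hK.girth' (k := g - 3) hf hfd h.dd₂ hd₂
    (hfd₂.mono (by grind) le_rfl) (by lia)
  have e5 := h.eq_of_adj_d hS.adj_right
  have e6 := h.y_ne_d₁
  have e7 := h.y_ne_d₂
  grind

end Config

lemma Winds.exists_centered {q : ℤ → V} {x y a b : V} (h : Winds g G q) (hreg : Reg G)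
    (hg : 3 ≤ g) (hx : ∃ i, q i = x) (hy : ∀ i, q i ≠ y) (hxy : G.Adj x y) (hxa : G.Adj x a)
    (hxb : G.Adj x b) (hya : y ≠ a) (hyb : y ≠ b) (hab : a ≠ b) :
    ∃ r, Winds g G r ∧ r (-1) = b ∧ r 0 = x ∧ r 1 = a ∧ ∀ i, r i ≠ y := by
  obtain ⟨k, hk⟩ := hx
  obtain ⟨r, hr, r0, hry⟩ : ∃ r, Winds g G r ∧ r 0 = x ∧ ∀ i, r i ≠ y :=
    ⟨_, h.shift k, by simpa using hk, fun i ↦ hy _⟩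
  have h1 := hreg.eq_or hxy hxa hxb hya hyb hab (hr.adj_of (j := 1) r0 rfl)
  have h2 := hreg.eq_or hxy hxa hxb hya hyb hab (hr.adj_of (i := -1) rfl r0).symm
  have h3 : r 1 ≠ r (-1) := hr.ne_of rfl
  have h4 := hry 1
  have h5 := hry (-1)
  by_cases ha : r 1 = a
  · exact ⟨r, hr, by grind, r0, ha, hry⟩
  · exact ⟨_, hr.neg, by simp only [neg_neg]; grind, by simpa using r0, by grind, fun i ↦ hry _⟩

lemma reg_of_isRegularOfDegree [Fintype V] [DecidableRel G.Adj] (h : G.IsRegularOfDegree 3) : Reg G := by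
  intro v
  rw [Set.ncard_eq_toFinset_card', ← h v]
  rfl

variable [Fintype V] [DecidableEq V]

lemma Partner.false_of_winds (h : Partner g G H) (hg : 5 ≤ g) (hn : g + 2 ≤ Fintype.card V)
    {p t q q' : ℤ → V} {x y : V} (hp : Winds g G p) (ht : Winds g G t) (hq : Winds g G q)
    (hq' : Winds g G q') (p0 : p 0 = x) (p1 : p 1 = y) (t0 : t 0 = x) (t1 : t 1 = y)
    (hpt : p ≠ t) (hqx : ∃ i, q i = x) (hqy : ∀ i, q i ≠ y) (hqy' : ∃ i, q' i = y)
    (hqx' : ∀ i, q' i ≠ x) : False := by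
  have hcd : t 2 ≠ p 2 := fun he ↦
    hpt (h.winds_eq hg hp ht (p0.trans t0.symm) (p1.trans t1.symm) he.symm)
  have hab : p (-1) ≠ t (-1) := by
    intro he
    have := h.winds_eq hg (hp.neg.shift (-1)) (ht.neg.shift (-1)) (by simp [p1, t1])
      (by simp [p0, t0]) (by simpa using he)
    exact hpt (funext fun i ↦ by simpa using congrFun this (1 - i))
  have hxy : G.Adj x y := hp.adj_of p0 p1
  obtain ⟨r, hr, r1, r2, r3, hry⟩ := hq.exists_centered h.reg (by lia) hqx hqy hxy
    (hp.adj_of rfl p0).symm (ht.adj_of rfl t0).symm (hp.ne_of p1).symm (ht.ne_of t1).symm hab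
  obtain ⟨s, hs, s1, s2, s3, hsx⟩ := hq'.exists_centered h.reg (by lia) hqy' hqx' hxy.symm
    (hp.adj_of p1 rfl) (ht.adj_of t1 rfl) (hp.ne_of p0).symm (ht.ne_of t0).symm hcd.symm
  have hra : r 2 ≠ p (-2) := by
    intro he
    have := h.winds_eq hg hr hp.neg (by simp [r2, p0]) (by simp [r3]) he
    exact hry (-1) (by simp [this, p1])
  have hsd : s 2 ≠ p 3 := by
    intro he
    have := h.winds_eq hg hs (hp.shift 1) (by simp [s2, p1]) s3 he
    exact hsx (-1) (by simp [this, p0])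
  exact Config.false (p := p) (t := t) (r := r) (s := s) ⟨hg, h.girth, h.reg, hp, ht, hr, hs,
    rfl, rfl, p0, p1, rfl, rfl, rfl, t0, t1, rfl, r1, r2, r3, rfl, rfl, s1, s2, s3, rfl, hry, hsx,
    hab, hcd, hra, hsd⟩ h hn

end TwoDeck

/-- Standing hypotheses: `G` and `H` are 3-regular graphs on the same number `n` of vertices
with the same `(n-2)`-deck, `H` is not isomorphic to `G`, and `g` is the girth of `G`. -/
theorem edge_in_two_g_cycles
    {V W : Type*} [Fintype V] [Fintype W] [DecidableEq V] [DecidableEq W]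
    (G : SimpleGraph V) (H : SimpleGraph W)
    [DecidableRel G.Adj] [DecidableRel H.Adj]
    (hG : G.IsRegularOfDegree 3) (hH : H.IsRegularOfDegree 3)
    (hcard : Fintype.card V = Fintype.card W)
    (hdeck : SameDeck G H (Fintype.card V - 2))
    (hniso : ¬ Nonempty (G ≃g H))
    (g : ℕ) (hgirth : G.egirth = g)
    (x y : V) (hxy : G.Adj x y)
    (v₁ v₂ : V) (C : G.Walk v₁ v₁) (D : G.Walk v₂ v₂)
    (hC : C.IsCycle) (hD : D.IsCycle) (hCl : C.length = g) (hDl : D.length = g)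
    (hCD : {e | e ∈ C.edges} ≠ {e | e ∈ D.edges})
    (hxyC : s(x, y) ∈ C.edges) (hxyD : s(x, y) ∈ D.edges) :
    ¬ ((∃ (w : V) (Q : G.Walk w w),
          Q.IsCycle ∧ Q.length = g ∧ x ∈ Q.support ∧ y ∉ Q.support) ∧
       (∃ (w : V) (R : G.Walk w w),
          R.IsCycle ∧ R.length = g ∧ y ∈ R.support ∧ x ∉ R.support)) := by
  rintro ⟨⟨w₁, Q, hQ, hQl, hxQ, hyQ⟩, ⟨w₂, R, hR, hRl, hyR, hxR⟩⟩
  let i : H.comap (Fintype.equivOfCardEq hcard) ≃g H := Iso.comap _ _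
  have h3 : TwoDeck.Partner 3 G (H.comap (Fintype.equivOfCardEq hcard)) :=
    ⟨TwoDeck.reg_of_isRegularOfDegree hG, (TwoDeck.reg_of_isRegularOfDegree hH).of_iso i,
      three_le_egirth, three_le_egirth, TwoDeck.sameDeck_of_iso hdeck i.symm,
      fun ⟨f⟩ ↦ hniso ⟨f.symm.trans i⟩⟩
  obtain ⟨hg, hn, hP⟩ := h3.five_le hgirth
  obtain ⟨p', hp', hpC, hpE⟩ := TwoDeck.exists_winds_of_isCycle C hC hCl
  obtain ⟨t', ht', htD, htE⟩ := TwoDeck.exists_winds_of_isCycle D hD hDl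
  obtain ⟨q, hq, hqQ, -⟩ := TwoDeck.exists_winds_of_isCycle Q hQ hQl
  obtain ⟨r, hr, hrR, -⟩ := TwoDeck.exists_winds_of_isCycle R hR hRl
  obtain ⟨p, hp, p0, p1, -, hpE'⟩ := hp'.exists_oriented hgirth.ge (by lia)
    ((hpC x).1 (C.fst_mem_support_of_mem_edges hxyC))
    ((hpC y).1 (C.snd_mem_support_of_mem_edges hxyC)) hxy
  obtain ⟨t, ht, t0, t1, -, htE'⟩ := ht'.exists_oriented hgirth.ge (by lia)
    ((htD x).1 (D.fst_mem_support_of_mem_edges hxyD))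
    ((htD y).1 (D.snd_mem_support_of_mem_edges hxyD)) hxy
  refine hP.false_of_winds hg hn hp ht hq hr p0 p1 t0 t1 ?_ ((hqQ x).1 hxQ) ?_ ((hrR y).1 hyR) ?_
  · rintro rfl
    refine hCD (Set.ext fun e ↦ ?_)
    change e ∈ C.edges ↔ e ∈ D.edges
    rw [hpE, htE, ← hpE', ← htE']
  · exact fun k hk ↦ hyQ ((hqQ y).2 ⟨k, hk⟩)
  · exact fun k hk ↦ hxR ((hrR x).2 ⟨k, hk⟩)
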